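/- Let α0,α1,α2,α3,α4 be complex numbers with α0+α1+2α2+α3+α4=1. The Sasano system D4(α0,α1,α2,α3,α4) admits a rational solution if and only if at least one of the following six conditions holds: (1) α0−α1 ∈ ℤ, α3+α4 ∈ ℤ, and (α0−α1)−(α3+α4) ∈ 2ℤ; (2) α0−α1 ∈ ℤ, α3−α4 ∈ ℤ, and (α0−α1)−(α3−α4) ∈ 2ℤ; (3) α0+α1 ∈ ℤ, α3+α4 ∈ ℤ, and (α0+α1)−(α3+α4) ∈ 2ℤ; (4) α0+α1 ∈ ℤ, α3−α4 ∈ ℤ, and (α0+α1)−(α3−α4) ∈ 2ℤ; (5) α0−α1 ∈ ℤ, α0+α1 ∈ ℤ, and (α0+α1)−(α0−α1) is an odd integer; (6) α3−α4 ∈ ℤ, α3+α4 ∈ ℤ, and (α3+α4)−(α3−α4) is an odd integer. -/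

import Mathlib

open Filter Topology Polynomial

noncomputable section

/-- The four equations of the Sasano system of type `D₄⁽¹⁾` at the point `t`. -/
def D4Eqs (a0 a1 a2 a3 a4 : ℂ) (x y z w : ℂ → ℂ) (t : ℂ) : Prop :=
  (t * deriv x t = 2 * x t ^ 2 * y t - x t ^ 2 + (a0 + a1) * x t - 2 * w t + t) ∧
  (t * deriv y t = -2 * x t * y t ^ 2 + 2 * x t * y t - (a0 + a1) * y t + a1) ∧
  (t * deriv z t =
      2 * z t ^ 2 * w t - t * z t ^ 2 - (1 - a3 - a4) * z t + 1 - 2 * y t) ∧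
  (t * deriv w t =
      -2 * z t * w t ^ 2 + 2 * t * z t * w t + (1 - a3 - a4) * w t + a3 * t)

/-- A complex rational function: a quotient of two polynomials (with junk value `0`
at poles), regarded as a function on `ℂ`. -/
def IsRatFn (f : ℂ → ℂ) : Prop :=
  ∃ p q : Polynomial ℂ, q ≠ 0 ∧ ∀ t : ℂ, f t = p.eval t / q.eval t

/-- A rational solution of the Sasano system `D₄⁽¹⁾`: a quadruple of rational functions
satisfying the four equations outside a finite set. -/
def IsRatSolD4 (a0 a1 a2 a3 a4 : ℂ) (x y z w : ℂ → ℂ) : Prop :=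
  IsRatFn x ∧ IsRatFn y ∧ IsRatFn z ∧ IsRatFn w ∧
    ∃ S : Set ℂ, S.Finite ∧ ∀ t ∉ S, D4Eqs a0 a1 a2 a3 a4 x y z w t

abbrev RF := RatFunc ℂ

abbrev io : ℂ[X] →+* RF := algebraMap ℂ[X] (RatFunc ℂ)

lemma io_inj {p q : ℂ[X]} : io p = io q ↔ p = q :=
  (RatFunc.algebraMap_injective ℂ).eq_iff

lemma io_ne {p : ℂ[X]} (h : p ≠ 0) : io p ≠ 0 := RatFunc.algebraMap_ne_zero h

lemma rep (f : RF) : ∃ p q : ℂ[X], q ≠ 0 ∧ f = io p / io q :=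
  ⟨f.num, f.denom, f.denom_ne_zero, (RatFunc.num_div_denom f).symm⟩

/-- The derivation `t d/dt` on rational functions. -/
def Dn (f : RF) : RF :=
  io X * (io (derivative f.num) * io f.denom - io f.num * io (derivative f.denom)) /
    (io f.denom) ^ 2

lemma Dn_div (p q : ℂ[X]) (hq : q ≠ 0) :
    Dn (io p / io q) = io X * (io (derivative p) * io q - io p * io (derivative q)) / (io q) ^ 2 := by
  set f : RF := io p / io q with hf
  have hd := io_ne f.denom_ne_zero
  have hq' := io_ne hq
  have h0 : io f.num / io f.denom = io p / io q := by rw [← hf]; exact RatFunc.num_div_denom f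
  have h1 : io f.num * io q = io p * io f.denom := by
    rwa [div_eq_div_iff hd hq'] at h0
  have h2 : f.num * q = p * f.denom := by
    rw [← io_inj]; simpa using h1
  have h3 := congrArg derivative h2
  rw [derivative_mul, derivative_mul, ← io_inj] at h3
  simp only [map_add, map_mul] at h3
  unfold Dn
  rw [div_eq_div_iff (pow_ne_zero _ hd) (pow_ne_zero _ hq')]
  generalize io f.num = n at *
  generalize io f.denom = m at *
  generalize io (derivative f.num) = n' at *
  generalize io (derivative f.denom) = m' at *
  generalize io (derivative p) = p' at *
  generalize io (derivative q) = q' at *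
  generalize io p = P at *
  generalize io q = Q at *
  generalize io X = x at *
  linear_combination x * m * Q * h3 - x * (m' * Q + m * q') * h1

lemma Dn_add (f g : RF) : Dn (f + g) = Dn f + Dn g := by
  obtain ⟨p, q, hq, rfl⟩ := rep f
  obtain ⟨p', q', hq', rfl⟩ := rep g
  have h1 := io_ne hq
  have h2 := io_ne hq'
  have : io p / io q + io p' / io q' = io (p * q' + p' * q) / io (q * q') := by
    simp only [map_add, map_mul]; field_simp
  rw [this, Dn_div _ _ (mul_ne_zero hq hq'), Dn_div _ _ hq, Dn_div _ _ hq']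
  simp only [map_add, map_mul, derivative_add, derivative_mul]
  field_simp
  ring

lemma Dn_mul (f g : RF) : Dn (f * g) = f * Dn g + g * Dn f := by
  obtain ⟨p, q, hq, rfl⟩ := rep f
  obtain ⟨p', q', hq', rfl⟩ := rep g
  have h1 := io_ne hq
  have h2 := io_ne hq'
  have : io p / io q * (io p' / io q') = io (p * p') / io (q * q') := by
    simp only [map_mul]; field_simp
  rw [this, Dn_div _ _ (mul_ne_zero hq hq'), Dn_div _ _ hq, Dn_div _ _ hq']
  simp only [map_add, map_mul, derivative_mul]
  field_simp
  ring

abbrev cc : ℂ →+* RF := RatFunc.C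

lemma cc_eq (a : ℂ) : cc a = io (Polynomial.C a) := (RatFunc.algebraMap_C a).symm

lemma Dn_poly (p : ℂ[X]) : Dn (io p) = io (X * derivative p) := by
  have := Dn_div p 1 one_ne_zero
  simpa using this

lemma Dn_cc (a : ℂ) : Dn (cc a) = 0 := by
  rw [cc_eq, Dn_poly]; simp

/-- the derivation, bundled -/
def D : Derivation ℂ RF RF :=
  Derivation.mk' { toFun := Dn
                   map_add' := Dn_add
                   map_smul' := fun a f => by
                    simp only [RingHom.id_apply]
                    have : ∀ g : RF, a • g = cc a * g := fun g => by
                      rw [Algebra.smul_def]; rfl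
                    rw [this, this, Dn_mul, Dn_cc]; ring } (fun a b => by
    simpa using Dn_mul a b)

lemma D_apply (f : RF) : D f = Dn f := rfl

lemma D_mul (f g : RF) : D (f * g) = f * D g + g * D f := Dn_mul f g
lemma D_cc (a : ℂ) : D (cc a) = 0 := Dn_cc a
/-- the variable -/
def T : RF := io X
lemma T_ne : T ≠ 0 := io_ne X_ne_zero
lemma D_T : D T = T := by rw [D_apply, T, Dn_poly]; simp
lemma D_inv (f : RF) (hf : f ≠ 0) : D f⁻¹ = - D f / f ^ 2 := by
  have := D_mul f f⁻¹
  rw [mul_inv_cancel₀ hf, Derivation.map_one_eq_zero] at this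
  field_simp at this ⊢
  linear_combination -this
lemma D_div (f g : RF) (hg : g ≠ 0) : D (f / g) = (D f * g - f * D g) / g ^ 2 := by
  rw [div_eq_mul_inv, D_mul, D_inv g hg]; field_simp; ring

lemma D_pow (f : RF) (n : ℕ) : D (f ^ (n+1)) = (n + 1 : RF) * f ^ n * D f := by
  rw [Derivation.leibniz_pow]; simp; ring

structure Place where
  Val : RF → ℂ → Prop
  u : RF
  u_ne : u ≠ 0
  u_val : Val u 0
  add : ∀ {f g a b}, Val f a → Val g b → Val (f + g) (a + b)
  mul : ∀ {f g a b}, Val f a → Val g b → Val (f * g) (a * b)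
  const : ∀ a, Val (cc a) a
  inv : ∀ {f a}, Val f a → a ≠ 0 → Val f⁻¹ a⁻¹
  uniq : ∀ {f a b}, Val f a → Val f b → a = b
  fact : ∀ f, f ≠ 0 → ∃ (m n : ℕ) (g : RF) (a : ℂ), Val g a ∧ a ≠ 0 ∧ f * u ^ n = u ^ m * g
  der : ∀ {f a}, Val f a → ∃ b, Val (D f) b

/-- regularity and value at a finite point -/
def ValAt (c : ℂ) (f : RF) (a : ℂ) : Prop :=
  ∃ p q : ℂ[X], q.eval c ≠ 0 ∧ f = io p / io q ∧ p.eval c = a * q.eval c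

lemma ne_of_eval {c : ℂ} {q : ℂ[X]} (h : q.eval c ≠ 0) : q ≠ 0 := by
  rintro rfl; simp at h

lemma ValAt.D0 {c : ℂ} {f : RF} {a : ℂ} (h : ValAt c f a) :
    ∃ b, ValAt c (D f) b ∧ (c = 0 → b = 0) := by
  obtain ⟨p, q, h1, rfl, h3⟩ := h
  refine ⟨_, ⟨X * (derivative p * q - p * derivative q), q ^ 2, by simp [h1], ?_,
    (div_mul_cancel₀ _ (by simp [h1])).symm⟩, ?_⟩
  · rw [D_apply, Dn_div _ _ (ne_of_eval h1)]; simp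
  · rintro rfl; simp

def placeAt (c : ℂ) : Place where
  Val := ValAt c
  u := T - cc c
  u_ne := by
    rw [T, cc_eq, ← map_sub]; exact io_ne (X_sub_C_ne_zero c)
  u_val := ⟨X - Polynomial.C c, 1, by simp, by simp [T], by simp⟩
  add := by
    rintro f g a b ⟨p, q, h1, rfl, h3⟩ ⟨p', q', h1', rfl, h3'⟩
    have := io_ne (ne_of_eval h1)
    have := io_ne (ne_of_eval h1')
    refine ⟨p * q' + p' * q, q * q', by simp [h1, h1'], by simp; field_simp, ?_⟩
    simp [h3, h3']; ring
  mul := by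
    rintro f g a b ⟨p, q, h1, rfl, h3⟩ ⟨p', q', h1', rfl, h3'⟩
    have := io_ne (ne_of_eval h1)
    have := io_ne (ne_of_eval h1')
    refine ⟨p * p', q * q', by simp [h1, h1'], by simp; field_simp, ?_⟩
    simp [h3, h3']; ring
  const := fun a => ⟨Polynomial.C a, 1, by simp, by simp, by simp⟩
  inv := by
    rintro f a ⟨p, q, h1, rfl, h3⟩ ha
    refine ⟨q, p, by simp [h3, ha, h1], by simp, ?_⟩
    rw [h3]; field_simp
  uniq := by
    rintro f a b ⟨p, q, h1, rfl, h3⟩ ⟨p', q', h1', h2, h3'⟩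
    rw [div_eq_div_iff (io_ne (ne_of_eval h1)) (io_ne (ne_of_eval h1')), ← map_mul, ← map_mul,
      io_inj] at h2
    have := congrArg (Polynomial.eval c) h2
    simp only [eval_mul, h3, h3'] at this
    apply mul_right_cancel₀ (mul_ne_zero h1 h1')
    linear_combination this
  fact := by
    intro f hf
    obtain ⟨p, q, hq, rfl⟩ := rep f
    have hp : p ≠ 0 := by rintro rfl; simp at hf
    obtain ⟨p1, e1, n1⟩ := exists_eq_pow_rootMultiplicity_mul_and_not_dvd p hp c
    obtain ⟨q1, e2, n2⟩ := exists_eq_pow_rootMultiplicity_mul_and_not_dvd q hq c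
    rw [dvd_iff_isRoot, IsRoot.def] at n1 n2
    refine ⟨p.rootMultiplicity c, q.rootMultiplicity c, io p1 / io q1, p1.eval c / q1.eval c,
      ⟨p1, q1, n2, rfl, by field_simp⟩, div_ne_zero n1 n2, ?_⟩
    have hq1 := io_ne (ne_of_eval n2)
    have hq0 := io_ne hq
    have E1 := congrArg io e1
    have E2 := congrArg io e2
    simp only [map_mul, map_pow, map_sub] at E1 E2
    rw [← cc_eq] at E1 E2
    rw [T, div_mul_eq_mul_div, mul_div_assoc', div_eq_div_iff hq0 hq1, E1]
    rw [mul_assoc, ← E2]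
  der := fun h => let ⟨b, hb, _⟩ := h.D0; ⟨b, hb⟩

/-- regularity and value at infinity -/
def ValInf (f : RF) (a : ℂ) : Prop :=
  ∃ (n : ℕ) (p q : ℂ[X]), p.natDegree ≤ n ∧ q.natDegree ≤ n ∧ q.coeff n ≠ 0 ∧ f = io p / io q ∧
    p.coeff n = a * q.coeff n

lemma ne_of_coeff {n : ℕ} {q : ℂ[X]} (h : q.coeff n ≠ 0) : q ≠ 0 := by
  rintro rfl; simp at h

lemma coeff_mul_aux {p q : ℂ[X]} {n m : ℕ} (hp : p.natDegree ≤ n) (hq : q.natDegree ≤ m) :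
    (p * q).coeff (n + m) = p.coeff n * q.coeff m := coeff_mul_add_eq_of_natDegree_le hp hq

lemma xder_deg {p : ℂ[X]} {n : ℕ} (hp : p.natDegree ≤ n) : (X * derivative p).natDegree ≤ n := by
  rw [natDegree_le_iff_coeff_eq_zero] at hp ⊢
  intro N hN
  obtain ⟨k, rfl⟩ : ∃ k, N = k + 1 := ⟨N - 1, by omega⟩
  rw [coeff_X_mul, coeff_derivative, hp _ hN]; simp

lemma xder_coeff {p : ℂ[X]} {n : ℕ} : (X * derivative p).coeff n = n * p.coeff n := by
  cases n with
  | zero => simp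
  | succ k => rw [coeff_X_mul, coeff_derivative]; push_cast; ring

lemma ValInf.D0 {f : RF} {a : ℂ} (h : ValInf f a) : ValInf (D f) 0 := by
  obtain ⟨n, p, q, dp, dq, h1, rfl, h3⟩ := h
  refine ⟨n + n, X * derivative p * q - p * (X * derivative q), q * q, ?_, ?_, ?_, ?_, ?_⟩
  · refine (natDegree_sub_le _ _).trans (max_le ?_ ?_)
    · exact natDegree_mul_le_of_le (xder_deg dp) dq
    · exact natDegree_mul_le_of_le dp (xder_deg dq)
  · exact natDegree_mul_le_of_le dq dq
  · rw [coeff_mul_aux dq dq]; exact mul_ne_zero h1 h1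
  · rw [D_apply, Dn_div _ _ (ne_of_coeff h1)]; simp only [map_sub, map_mul]; congr 1 <;> ring
  · rw [coeff_sub, coeff_mul_aux (xder_deg dp) dq, coeff_mul_aux dp (xder_deg dq), xder_coeff,
      xder_coeff]; ring

def placeInf : Place where
  Val := ValInf
  u := T⁻¹
  u_ne := inv_ne_zero T_ne
  u_val := ⟨1, 1, X, by simp, by simp, by simp, by simp [T], by simp [coeff_one]⟩
  add := by
    rintro f g a b ⟨n, p, q, dp, dq, h1, rfl, h3⟩ ⟨n', p', q', dp', dq', h1', rfl, h3'⟩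
    have := io_ne (ne_of_coeff h1)
    have := io_ne (ne_of_coeff h1')
    refine ⟨n + n', p * q' + q * p', q * q', ?_, ?_, ?_, by simp; field_simp, ?_⟩
    · exact (natDegree_add_le _ _).trans (max_le (natDegree_mul_le_of_le dp dq')
        (natDegree_mul_le_of_le dq dp'))
    · exact natDegree_mul_le_of_le dq dq'
    · rw [coeff_mul_aux dq dq']; exact mul_ne_zero h1 h1'
    · rw [coeff_add, coeff_mul_aux dq dq', coeff_mul_aux dp dq', coeff_mul_aux dq dp', h3, h3']; ring
  mul := by
    rintro f g a b ⟨n, p, q, dp, dq, h1, rfl, h3⟩ ⟨n', p', q', dp', dq', h1', rfl, h3'⟩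
    have := io_ne (ne_of_coeff h1)
    have := io_ne (ne_of_coeff h1')
    refine ⟨n + n', p * p', q * q', ?_, ?_, ?_, by simp; field_simp, ?_⟩
    · exact natDegree_mul_le_of_le dp dp'
    · exact natDegree_mul_le_of_le dq dq'
    · rw [coeff_mul_aux dq dq']; exact mul_ne_zero h1 h1'
    · rw [coeff_mul_aux dq dq', coeff_mul_aux dp dp', h3, h3']; ring
  const := fun a => ⟨0, Polynomial.C a, 1, by simp, by simp, by simp, by simp, by simp⟩
  inv := by
    rintro f a ⟨n, p, q, dp, dq, h1, rfl, h3⟩ ha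
    refine ⟨n, q, p, dq, dp, by simp [h3, ha, h1], by simp, ?_⟩
    rw [h3]; field_simp
  uniq := by
    rintro f a b ⟨n, p, q, dp, dq, h1, rfl, h3⟩ ⟨n', p', q', dp', dq', h1', h2, h3'⟩
    rw [div_eq_div_iff (io_ne (ne_of_coeff h1)) (io_ne (ne_of_coeff h1')), ← map_mul, ← map_mul,
      io_inj, mul_comm p' q] at h2
    have := congrArg (fun r => Polynomial.coeff r (n + n')) h2
    simp only [coeff_mul_aux dp dq', coeff_mul_aux dq dp', h3, h3'] at this
    apply mul_right_cancel₀ (mul_ne_zero h1 h1')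
    linear_combination this
  fact := by
    intro f hf
    obtain ⟨p, q, hq, rfl⟩ := rep f
    have hp : p ≠ 0 := by rintro rfl; simp at hf
    have hl1 : p.coeff p.natDegree ≠ 0 := by simpa using hp
    have hl2 : q.coeff q.natDegree ≠ 0 := by simpa using hq
    refine ⟨q.natDegree, p.natDegree, io (p * X ^ q.natDegree) / io (q * X ^ p.natDegree),
      p.coeff p.natDegree / q.coeff q.natDegree,
      ⟨p.natDegree + q.natDegree, _, _, ?_, ?_, ?_, rfl, ?_⟩, div_ne_zero hl1 hl2, ?_⟩
    · exact natDegree_mul_le_of_le le_rfl (by simp)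
    · rw [add_comm]; exact natDegree_mul_le_of_le le_rfl (by simp)
    · rw [add_comm, coeff_mul_aux le_rfl (by simp)]; simpa using hq
    · rw [coeff_mul_aux le_rfl (by simp)]
      rw [add_comm, coeff_mul_aux le_rfl (by simp)]
      simp only [coeff_X_pow_self]; field_simp
    · have := io_ne hq
      have := T_ne
      simp only [map_mul, map_pow]
      change _ = _ * (io p * T ^ _ / (io q * T ^ _))
      rw [inv_pow, inv_pow]
      field_simp
  der := fun h => ⟨0, h.D0⟩
namespace Place
variable (pl : Place)

def Reg (f : RF) : Prop := ∃ a, pl.Val f a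

variable {pl}

lemma congr {f g : RF} {a b : ℂ} (h : pl.Val f a) (h1 : g = f) (h2 : b = a) : pl.Val g b := by
  subst h1 h2; exact h
lemma num (n : ℕ) : pl.Val (n : RF) (n : ℂ) := pl.congr (pl.const n) (by simp) rfl
lemma two : pl.Val (2 : RF) 2 := pl.congr (pl.const 2) (map_ofNat cc 2).symm rfl
lemma four : pl.Val (4 : RF) 4 := pl.congr (pl.const 4) (map_ofNat cc 4).symm rfl
lemma one : pl.Val (1 : RF) 1 := pl.congr (pl.const 1) (by simp) rfl
lemma zero : pl.Val (0 : RF) 0 := pl.congr (pl.const 0) (by simp) rfl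
lemma neg {f : RF} {a : ℂ} (h : pl.Val f a) : pl.Val (-f) (-a) :=
  pl.congr (pl.mul (pl.const (-1)) h) (by simp) (by ring)
lemma sub {f g : RF} {a b : ℂ} (h : pl.Val f a) (h' : pl.Val g b) : pl.Val (f - g) (a - b) :=
  pl.congr (pl.add h (neg h')) (by ring) (by ring)
lemma pow {f : RF} {a : ℂ} (h : pl.Val f a) (n : ℕ) : pl.Val (f ^ n) (a ^ n) := by
  induction n with
  | zero => simpa using one
  | succ k ih => simpa [pow_succ] using pl.mul ih h
lemma upow (n : ℕ) : pl.Val (pl.u ^ (n + 1)) 0 := pl.congr (pow pl.u_val (n + 1)) rfl (by simp)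
lemma div {f g : RF} {a b : ℂ} (h : pl.Val f a) (h' : pl.Val g b) (hb : b ≠ 0) :
    pl.Val (f / g) (a / b) := pl.congr (pl.mul h (pl.inv h' hb)) (by rw [div_eq_mul_inv])
      (by rw [div_eq_mul_inv])

lemma Val.ne {f : RF} {a : ℂ} (h : pl.Val f a) (ha : a ≠ 0) : f ≠ 0 := by
  rintro rfl; exact ha (pl.uniq h zero)

lemma dich (f : RF) : pl.Reg f ∨ ∃ (k : ℕ) (g : RF) (a : ℂ), pl.Val g a ∧ a ≠ 0 ∧
    f = g / pl.u ^ (k + 1) := by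
  by_cases hf : f = 0
  · exact Or.inl ⟨0, hf ▸ zero⟩
  obtain ⟨m, n, g, a, h1, h2, h3⟩ := pl.fact f hf
  have hu := pl.u_ne
  rcases le_or_gt n m with h | h
  · left
    obtain ⟨j, rfl⟩ := Nat.exists_eq_add_of_le h
    refine ⟨_, pl.congr (pl.mul (pow pl.u_val j) h1) ?_ rfl⟩
    rw [pow_add] at h3
    apply mul_right_cancel₀ (pow_ne_zero n hu)
    rw [h3]; ring
  · right
    obtain ⟨j, rfl⟩ := Nat.exists_eq_add_of_lt h
    refine ⟨j, g, a, h1, h2, ?_⟩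
    rw [eq_div_iff (pow_ne_zero _ hu)]
    apply mul_left_cancel₀ (pow_ne_zero m hu)
    rw [← h3]; ring

lemma not_reg {f g : RF} {a : ℂ} {k : ℕ} (h : pl.Val g a) (ha : a ≠ 0)
    (e : f = g / pl.u ^ (k + 1)) : ¬ pl.Reg f := by
  rintro ⟨b, hb⟩
  have hu := pl.u_ne
  rw [eq_div_iff (pow_ne_zero _ hu)] at e
  have := pl.mul hb (upow k)
  rw [e] at this
  exact ha (by simpa using pl.uniq h this)

/-- a function with value zero is divisible by the uniformizer -/
lemma divis {f : RF} (h : pl.Val f 0) : ∃ g, pl.Reg g ∧ f = pl.u * g := by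
  have hu := pl.u_ne
  refine ⟨f / pl.u, ?_, by field_simp⟩
  rcases dich (pl := pl) (f / pl.u) with h1 | ⟨k, g, a, h1, h2, h3⟩
  · exact h1
  · exfalso
    have : f * pl.u ^ k = g := by
      field_simp at h3
      apply mul_left_cancel₀ hu
      rw [← h3]; ring
    have h4 := pl.mul h (pow pl.u_val k)
    rw [this] at h4
    exact h2 (by simpa using pl.uniq h1 h4)

lemma Dupow (k : ℕ) : pl.u * D (pl.u ^ k) = k * pl.u ^ k * D pl.u := by
  cases k with
  | zero => simp
  | succ n => rw [D_pow]; push_cast; ring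

lemma Dpole (g : RF) (k : ℕ) : D (g / pl.u ^ k) * pl.u ^ (k + 1) =
    D g * pl.u - k * g * D pl.u := by
  have hu := pl.u_ne
  rw [D_div _ _ (pow_ne_zero _ hu)]
  have := Dupow (pl := pl) k
  rw [div_mul_eq_mul_div, div_eq_iff (pow_ne_zero _ (pow_ne_zero _ hu))]
  linear_combination (-(g * pl.u ^ k)) * this

end Place

lemma two_ne : (2 : RF) ≠ 0 := two_ne_zero

/-- The symmetric form of the system -/
structure Sys (s d s' d' : ℂ) (x e z f : RF) : Prop where
  h1 : D x = 2 * x ^ 2 * e + cc s * x - 2 * T * f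
  h2 : 2 * D e = x * (1 - 4 * e ^ 2) - 2 * cc s * e - cc d
  h3 : D z = 2 * z ^ 2 * f + cc s' * z - 2 * T * e
  h4 : 2 * D f = z * (1 - 4 * f ^ 2) - 2 * cc s' * f - cc d'

lemma Sys.swap {s d s' d' : ℂ} {x e z f : RF} (h : Sys s d s' d' x e z f) :
    Sys s' d' s d z f x e := ⟨h.h3, h.h4, h.h1, h.h2⟩

lemma Sys.neg {s d s' d' : ℂ} {x e z f : RF} (h : Sys s d s' d' x e z f) :
    Sys s (-d) s' (-d') (-x) (-e) (-z) (-f) := by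
  refine ⟨?_, ?_, ?_, ?_⟩ <;> simp only [map_neg]
  · linear_combination -h.h1
  · linear_combination -h.h2
  · linear_combination -h.h3
  · linear_combination -h.h4

open Place

section
variable {pl : Place} {s d s' d' : ℂ} {x e z f : RF}

lemma reg_x (h : Sys s d s' d' x e z f) {e0 b : ℂ} (he : pl.Val e e0) (hb : pl.Val (D e) b)
    (hne : 1 - 4 * e0 ^ 2 ≠ 0) : pl.Val x ((2 * b + 2 * s * e0 + d) / (1 - 4 * e0 ^ 2)) := by
  have hd := sub one (pl.mul four (pow he 2))
  have hn := pl.add (pl.add (pl.mul two hb) (pl.mul (pl.mul two (pl.const s)) he)) (pl.const d)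
  refine pl.congr (div hn hd hne) ?_ rfl
  rw [eq_div_iff (Val.ne hd hne)]
  linear_combination -h.h2

lemma reg_Te (h : Sys s d s' d' x e z f) (hx : pl.Reg x) (he : pl.Reg e) : pl.Reg (T * f) := by
  obtain ⟨x0, hx⟩ := hx
  obtain ⟨e0, he⟩ := he
  obtain ⟨b, hb⟩ := pl.der hx
  refine ⟨_, pl.congr (div (sub (pl.add (pl.mul (pl.mul two (pow hx 2)) he)
    (pl.mul (pl.const s) hx)) hb) two two_ne_zero) ?_ rfl⟩
  rw [eq_div_iff two_ne]
  linear_combination h.h1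

/-- At a finite nonzero point: the consequence of a pole of `e`. -/
lemma pole_c (h : Sys s d s' d' x e z f) {c : ℂ} (hc : c ≠ 0) (hu : D pl.u = T) (hT : pl.Val T c)
    {k : ℕ} {g : RF} {a : ℂ} (hg : pl.Val g a) (ha : a ≠ 0) (he : e = g / pl.u ^ (k + 1)) :
    pl.Reg x ∧ ∃ m, pl.Val m ((k + 1) * c / (4 * a)) ∧ f * pl.u = pl.u ^ k * m := by
  have hu0 := pl.u_ne
  obtain ⟨b, hb⟩ := pl.der hg
  have hden := sub (upow (2 * k + 1)) (pl.mul four (pow hg 2))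
  have hdne : (0 - 4 * a ^ 2 : ℂ) ≠ 0 := by
    rw [zero_sub]; exact neg_ne_zero.2 (mul_ne_zero (by norm_num) (pow_ne_zero _ ha))
  have hnum := pl.add (pl.add (pl.mul two (sub (pl.mul hb pl.u_val)
    (pl.mul (pl.mul (num (k + 1)) hg) hT)))
    (pl.mul (pl.mul (pl.mul two (pl.const s)) hg) pl.u_val)) (pl.mul (pl.const d) (upow (k + 1)))
  have hv := div hnum hden hdne
  generalize hhdef : (_ / _ : RF) = hh at hv
  have hxe : x = pl.u ^ k * hh := by
    rw [← hhdef, mul_div_assoc', eq_div_iff (Val.ne hden hdne)]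
    have h2 := h.h2
    have hD := Dpole (pl := pl) g (k + 1)
    rw [← he, hu] at hD
    have he' : e * pl.u ^ (k + 1) = g := by rw [he]; field_simp
    rw [← he'] at hD ⊢
    linear_combination (-(pl.u ^ (2 * k + 2))) * h2 + 2 * pl.u ^ k * hD
  have hv' : pl.Val hh ((k + 1) * c / (2 * a)) := by
    refine pl.congr hv rfl ?_
    push_cast; field_simp; ring
  obtain ⟨b', hb'⟩ := pl.der hv
  have hm := sub (sub (pl.add (pl.mul (pl.mul two (pow hv' 2)) hg) (pl.mul (pl.mul (pl.const s)
    pl.u_val) hv')) (pl.mul (pl.mul (num k) hT) hv')) (pl.mul pl.u_val hb')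
  have hm' := div hm (pl.mul two hT) (mul_ne_zero two_ne_zero hc)
  refine ⟨⟨_, pl.congr (pl.mul (pow pl.u_val k) hv') hxe rfl⟩, _,
    pl.congr hm' rfl ?_, ?_⟩
  · field_simp; ring
  · rw [mul_div_assoc', eq_div_iff (mul_ne_zero two_ne T_ne)]
    have h1 := h.h1
    have hD := D_mul (pl.u ^ k) hh
    rw [← hxe] at hD
    have hDu := Dupow (pl := pl) k
    rw [hu] at hDu
    have he' : e * pl.u ^ (k + 1) = g := by rw [he]; field_simp
    rw [← he']
    generalize D x = dx at h1 hD
    rw [hxe] at h1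
    linear_combination pl.u * h1 - pl.u * hD - hh * hDu

end
section
variable {pl : Place} {s d s' d' : ℂ} {x e z f : RF}

lemma reg_of_T {c : ℂ} (hc : c ≠ 0) (hT : pl.Val T c) {f : RF} (h : pl.Reg (T * f)) : pl.Reg f := by
  obtain ⟨a, h⟩ := h
  refine ⟨_, pl.congr (div h hT hc) ?_ rfl⟩
  rw [mul_div_cancel_left₀ _ T_ne]

/-- At a finite nonzero point: possible behaviours of `e`. -/
lemma alt_c (h : Sys s d s' d' x e z f) {c : ℂ} (hc : c ≠ 0) (hu : D pl.u = T) (hT : pl.Val T c) :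
    pl.Reg e ∨ (pl.Reg x ∧ (¬ pl.Reg f ∨ ∃ a, a ≠ 0 ∧ pl.Val (e * pl.u ^ 2) a ∧
      pl.Val f (c / (2 * a)))) := by
  rcases dich (pl := pl) e with he | ⟨k, g, a, hg, ha, he⟩
  · exact Or.inl he
  right
  have hu0 := pl.u_ne
  obtain ⟨hx, m, hm, hfm⟩ := pole_c h hc hu hT hg ha he
  refine ⟨hx, ?_⟩
  rcases k with _ | _ | k
  · left
    refine not_reg (k := 0) hm ?_ ?_
    · simp [hc, ha]
    · rw [eq_div_iff (pow_ne_zero _ hu0)]; simpa using hfm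
  · right
    refine ⟨a, ha, pl.congr hg ?_ rfl, pl.congr hm ?_ ?_⟩
    · rw [he]; field_simp
    · apply mul_right_cancel₀ hu0; rw [hfm]; ring
    · push_cast; field_simp; norm_num
  · exfalso
    have hf : pl.Val f 0 := by
      refine pl.congr (pl.mul (upow k) hm) ?_ (by simp)
      apply mul_right_cancel₀ hu0; rw [hfm]; ring
    obtain ⟨b, hb⟩ := pl.der hf
    have hz := reg_x h.swap hf hb (by simp)
    have := reg_of_T hc hT (reg_Te h.swap ⟨_, hz⟩ ⟨_, hf⟩)
    exact not_reg hg ha he this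

/-- At a finite nonzero point, `x` has at most a simple pole, with residue in `c ℤ`. -/
lemma res_c (h : Sys s d s' d' x e z f) {c : ℂ} (hc : c ≠ 0) (hu : D pl.u = T) (hT : pl.Val T c) :
    ∃ n : ℤ, pl.Val (x * pl.u) (n * c) := by
  have hu0 := pl.u_ne
  rcases dich (pl := pl) x with ⟨x0, hx⟩ | ⟨j, g, a, hg, ha, hx⟩
  · exact ⟨0, pl.congr (pl.mul hx pl.u_val) rfl (by simp)⟩
  have hxn := not_reg hg ha hx
  obtain ⟨e0, he⟩ : pl.Reg e := by
    rcases alt_c h hc hu hT with h' | h'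
    · exact h'
    · exact absurd h'.1 hxn
  have he0 : 1 - 4 * e0 ^ 2 = 0 := by
    by_contra hne
    obtain ⟨b, hb⟩ := pl.der he
    exact hxn ⟨_, reg_x h he hb hne⟩
  have he0' : e0 ≠ 0 := by rintro rfl; simp at he0
  obtain ⟨r, hr, hr'⟩ : ∃ r, pl.Val (f * pl.u ^ 2) r ∧ (r = 0 ∨ (r ≠ 0 ∧ e0 = c / (2 * r))) := by
    rcases alt_c h.swap hc hu hT with ⟨f0, hf⟩ | ⟨_, h' | ⟨r, hr0, hr, hr'⟩⟩
    · exact ⟨_, pl.mul hf (upow 1), Or.inl (by simp)⟩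
    · exact absurd ⟨e0, he⟩ h'
    · exact ⟨r, hr, Or.inr ⟨hr0, pl.uniq he hr'⟩⟩
  obtain ⟨b, hb⟩ := pl.der hg
  have hD := Dpole (pl := pl) g (j + 1)
  rw [← hx, hu] at hD
  have hx' : x * pl.u ^ (j + 1) = g := by rw [hx]; field_simp
  have h1 := h.h1
  generalize D x = dx at h1 hD
  have key : pl.u ^ j * (D g * pl.u - (j + 1 : ℕ) * g * T) =
      2 * g ^ 2 * e + cc s * g * pl.u ^ (j + 1) - 2 * T * (f * pl.u ^ 2) * pl.u ^ (2 * j) := by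
    rw [← hD, h1, ← hx']; ring
  have hR := sub (pl.add (pl.mul (pl.mul two (pow hg 2)) he) (pl.mul (pl.mul (pl.const s) hg)
    (upow j))) (pl.mul (pl.mul (pl.mul two hT) hr) (pow pl.u_val (2 * j)))
  have hL := pl.mul (pow pl.u_val j) (sub (pl.mul hb pl.u_val) (pl.mul (pl.mul (num (j + 1)) hg) hT))
  rw [key] at hL
  have E := pl.uniq hL hR
  rcases j with _ | j
  · have hxu : pl.Val (x * pl.u) a := pl.congr hg (by rw [← hx']; ring) rfl
    simp at E
    have hfac : (2 * e0 - 1) * (2 * e0 + 1) = 0 := by linear_combination -he0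
    rcases hr' with hr0 | ⟨hr0, hr'⟩
    · subst hr0
      have E' : a * (2 * e0 * a + c) = 0 := by linear_combination -E
      have E'' := (mul_eq_zero.1 E').resolve_left ha
      rcases mul_eq_zero.1 hfac with h2 | h2
      · exact ⟨-1, pl.congr hxu rfl (by push_cast; linear_combination -E'' + a * h2)⟩
      · exact ⟨1, pl.congr hxu rfl (by push_cast; linear_combination E'' - a * h2)⟩
    · have hre : 2 * r * e0 = c := by rw [hr']; field_simp
      rcases mul_eq_zero.1 hfac with h2 | h2
      · have e1 : e0 = 1 / 2 := by linear_combination h2 / 2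
        subst e1
        have : (a - c) * (a + 2 * c) = 0 := by linear_combination -E + 2 * c * hre
        rcases mul_eq_zero.1 this with h3 | h3
        · exact ⟨1, pl.congr hxu rfl (by push_cast; linear_combination -h3)⟩
        · exact ⟨-2, pl.congr hxu rfl (by push_cast; linear_combination -h3)⟩
      · have e1 : e0 = -1 / 2 := by linear_combination h2 / 2
        subst e1
        have : (a + c) * (a - 2 * c) = 0 := by linear_combination E + 2 * c * hre
        rcases mul_eq_zero.1 this with h3 | h3
        · exact ⟨-1, pl.congr hxu rfl (by push_cast; linear_combination -h3)⟩
        · exact ⟨2, pl.congr hxu rfl (by push_cast; linear_combination -h3)⟩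
  · exfalso
    simp at E
    tauto

/-- four times `H - P` -/
def GG (s d s' d' : ℂ) (x e z f : RF) : RF :=
  4 * (x * e) ^ 2 + 4 * cc s * (x * e) - x ^ 2 + 2 * cc d * x + 4 * (z * f) ^ 2
    + 4 * cc s' * (z * f) - z ^ 2 + 2 * cc d' * z - 8 * T * e * f - 4 * (x * e)

lemma D_GG (h : Sys s d s' d' x e z f) :
    D (GG s d s' d' x e z f) = -2 * (x ^ 2 - cc d * x) := by
  unfold GG
  have e2 : ∀ g : RF, D (2 * g) = 2 * D g := fun g => by
    rw [← map_ofNat cc 2, D_mul, D_cc]; ring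
  have e4 : ∀ g : RF, D (4 * g) = 4 * D g := fun g => by
    rw [← map_ofNat cc 4, D_mul, D_cc]; ring
  have e8 : ∀ g : RF, D (8 * g) = 8 * D g := fun g => by
    rw [← map_ofNat cc 8, D_mul, D_cc]; ring
  simp only [map_add, map_sub, mul_assoc, pow_two, e2, e4, e8, D_mul, D_cc, D_T]
  have h1 := h.h1
  have h2 := h.h2
  have h3 := h.h3
  have h4 := h.h4
  generalize D x = dx at *
  generalize D e = de at *
  generalize D z = dz at *
  generalize D f = df at *
  linear_combination (8 * x * e ^ 2 + 4 * cc s * e - 2 * x + 2 * cc d - 4 * e) * h1 +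
    (8 * z * f ^ 2 + 4 * cc s' * f - 2 * z + 2 * cc d') * h3 +
    (4 * x ^ 2 * e + 2 * cc s * x - 4 * T * f - 2 * x) * h2 +
    (4 * z ^ 2 * f + 2 * cc s' * z - 4 * T * e) * h4

lemma res_G (h : Sys s d s' d' x e z f) {c : ℂ} (hc : c ≠ 0) (hu : D pl.u = T) (hT : pl.Val T c) :
    ∃ n : ℤ, pl.Val ((GG s d s' d' x e z f + 2 * x) * pl.u) (4 * n * c) := by
  have hu0 := pl.u_ne
  obtain ⟨n, hn⟩ := res_c h hc hu hT
  have hG := D_GG h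
  generalize GG s d s' d' x e z f = G at *
  have hpar : ∃ m : ℤ, (2 * m : ℂ) = n * (n + 1) := by
    obtain ⟨m, hm⟩ := (Int.even_mul_succ_self n).two_dvd
    exact ⟨m, by exact_mod_cast hm.symm⟩
  suffices hGu : pl.Val (G * pl.u) (2 * n ^ 2 * c) by
    obtain ⟨m, hm⟩ := hpar
    refine ⟨m, pl.congr (pl.add hGu (pl.mul two hn)) (by ring) (by linear_combination 2 * c * hm)⟩
  have hR := pl.mul (neg two) (sub (pow hn 2) (pl.mul (pl.mul (pl.const d) hn) pl.u_val))
  rcases dich (pl := pl) G with ⟨G0, h0⟩ | ⟨j, g, a, hg, ha, hx⟩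
  · obtain ⟨b, hb⟩ := pl.der h0
    have hL := pl.mul hb (upow 1)
    have E := pl.uniq (pl.congr hL (by rw [hG]; ring) rfl) hR
    simp [hc] at E
    subst E
    exact pl.congr (pl.mul h0 pl.u_val) rfl (by simp)
  · obtain ⟨b, hb⟩ := pl.der hg
    have hD := Dpole (pl := pl) g (j + 1)
    rw [← hx, hu, hG] at hD
    have hL := sub (pl.mul hb pl.u_val) (pl.mul (pl.mul (num (j + 1)) hg) hT)
    rw [← hD] at hL
    have hR' := pl.mul hR (pow pl.u_val j)
    have E := pl.uniq (pl.congr hL (by ring) rfl) hR'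
    rcases j with _ | j
    · refine pl.congr hg (by rw [hx, zero_add, pow_one]; field_simp) ?_
      simp at E
      apply mul_right_cancel₀ hc
      linear_combination -E
    · exfalso
      simp [hc, ha] at E
      exact Nat.cast_add_one_ne_zero (R := ℂ) (j + 1) (by push_cast; linear_combination E)
end
section
variable {pl : Place} {s d s' d' : ℂ} {x e z f : RF}

/-- At zero or infinity: the consequence of a pole of `e`. -/
lemma pole_0 (h : Sys s d s' d' x e z f) {σ : ℂ} (hu : D pl.u = cc σ * pl.u)
    (hder : ∀ {g a}, pl.Val g a → pl.Val (D g) 0)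
    {k : ℕ} {g : RF} {a : ℂ} (hg : pl.Val g a) (ha : a ≠ 0) (he : e = g / pl.u ^ (k + 1)) :
    ∃ hh m, pl.Val hh (((k + 1) * σ - s) / (2 * a)) ∧ pl.Val m 0 ∧ x = pl.u ^ (k + 1) * hh ∧
      T * f = pl.u ^ (k + 1) * m := by
  have hu0 := pl.u_ne
  have hb := hder hg
  have he' : e * pl.u ^ (k + 1) = g := by rw [he]; field_simp
  have hden := sub (upow (2 * k + 1)) (pl.mul four (pow hg 2))
  have hdne : (0 - 4 * a ^ 2 : ℂ) ≠ 0 := by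
    rw [zero_sub]; exact neg_ne_zero.2 (mul_ne_zero (by norm_num) (pow_ne_zero _ ha))
  have hnum := pl.add (pl.add (pl.mul two (sub hb
    (pl.mul (pl.mul (num (k + 1)) (pl.const σ)) hg)))
    (pl.mul (pl.mul two (pl.const s)) hg)) (pl.mul (pl.const d) (upow k))
  have hv := div hnum hden hdne
  generalize hhdef : (_ / _ : RF) = hh at hv
  have hxe : x = pl.u ^ (k + 1) * hh := by
    rw [← hhdef, mul_div_assoc', eq_div_iff (Val.ne hden hdne)]
    have h2 := h.h2
    have hD := Dpole (pl := pl) g (k + 1)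
    rw [← he, hu] at hD
    have hD' : D e * pl.u ^ (k + 1) = D g - (k + 1 : ℕ) * cc σ * g := by
      apply mul_right_cancel₀ hu0
      linear_combination hD
    rw [← hD', ← he']
    linear_combination (-(pl.u ^ (2 * k + 2))) * h2
  have hv' : pl.Val hh (((k + 1) * σ - s) / (2 * a)) := by
    refine pl.congr hv rfl ?_
    push_cast; field_simp; ring
  have hb' := hder hv
  have hm := sub (sub (pl.add (pl.mul (pl.mul two (pow hv' 2)) hg) (pl.mul (pl.const s)
    hv')) (pl.mul (pl.mul (num (k + 1)) (pl.const σ)) hv')) hb'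
  have hm' := div hm two two_ne_zero
  refine ⟨hh, _, hv', pl.congr hm' rfl ?_, hxe, ?_⟩
  · push_cast; field_simp; ring
  · rw [mul_div_assoc', eq_div_iff two_ne]
    have h1 := h.h1
    have hD := D_mul (pl.u ^ (k + 1)) hh
    rw [← hxe] at hD
    have hDu := Dupow (pl := pl) (k + 1)
    rw [hu] at hDu
    have hDu' : D (pl.u ^ (k + 1)) = (k + 1 : ℕ) * cc σ * pl.u ^ (k + 1) := by
      apply mul_left_cancel₀ hu0
      linear_combination hDu
    rw [hDu'] at hD
    generalize D x = dx at h1 hD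
    rw [hxe] at h1
    rw [← he']
    linear_combination h1 - hD

end

lemma der0 {g : RF} {a : ℂ} (h : (placeAt 0).Val g a) : (placeAt 0).Val (D g) 0 := by
  obtain ⟨b, hb, hb'⟩ := ValAt.D0 h
  rw [hb' rfl] at hb; exact hb

lemma derInf {g : RF} {a : ℂ} (h : placeInf.Val g a) : placeInf.Val (D g) 0 := ValInf.D0 h

lemma u_zero : (placeAt 0).u = T := by simp [placeAt]
lemma u_inf : placeInf.u = T⁻¹ := rfl
lemma T_val (c : ℂ) : (placeAt c).Val T c := ⟨X, 1, by simp, by simp [T], by simp⟩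
lemma u_at (c : ℂ) : D (placeAt c).u = T := by
  change D (T - cc c) = T
  rw [map_sub, D_T, D_cc, sub_zero]

section
variable {s d s' d' : ℂ} {x e z f : RF}

lemma val_GG {pl : Place} {x0 z0 P Q : ℂ} (hx : pl.Val x x0) (hz : pl.Val z z0)
    (hP : pl.Val (x * e) P) (hQ : pl.Val (z * f) Q) (hR : pl.Val (T * e * f) 0) :
    pl.Val (GG s d s' d' x e z f) (4 * P ^ 2 + 4 * s * P - x0 ^ 2 + 2 * d * x0 + 4 * Q ^ 2 +
      4 * s' * Q - z0 ^ 2 + 2 * d' * z0 - 4 * P) := by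
  refine pl.congr (sub (sub (pl.add (sub (pl.add (pl.add (pl.add (sub (pl.add (pl.mul four (pow hP 2))
    (pl.mul (pl.mul four (pl.const s)) hP)) (pow hx 2)) (pl.mul (pl.mul two (pl.const d)) hx))
    (pl.mul four (pow hQ 2))) (pl.mul (pl.mul four (pl.const s')) hQ)) (pow hz 2))
    (pl.mul (pl.mul two (pl.const d')) hz)) (pl.mul (pl.const 8) hR)) (pl.mul four hP)) ?_ ?_
  · unfold GG; rw [map_ofNat]; ring
  · ring

/-- Infinity: only one possible behaviour. -/
lemma at_inf_e (h : Sys s d s' d' x e z f) : placeInf.Reg e := by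
  rcases dich (pl := placeInf) e with he | ⟨k, g, a, hg, ha, he⟩
  · exact he
  exfalso
  have hu : D placeInf.u = cc (-1) * placeInf.u := by
    rw [u_inf, D_inv _ T_ne, D_T]; have := T_ne; simp; field_simp
  obtain ⟨hh, m, -, hm, -, hf⟩ := pole_0 h hu derInf hg ha he
  have hT := T_ne
  have hf' : placeInf.Val f 0 := by
    refine placeInf.congr (placeInf.mul (upow (k + 1)) hm) ?_ (by simp)
    rw [u_inf] at hf ⊢
    apply mul_left_cancel₀ hT
    rw [hf, pow_succ _ (k + 1)]; field_simp
  have hz := reg_x h.swap hf' (derInf hf') (by simp)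
  obtain ⟨b, hb⟩ := reg_Te h.swap ⟨_, hz⟩ ⟨_, hf'⟩
  refine not_reg hg ha he ⟨_, placeInf.congr (placeInf.mul placeInf.u_val hb) ?_ rfl⟩
  rw [u_inf]; field_simp

lemma val_of_T {b : ℂ} (hb : placeInf.Val (T * f) b) : placeInf.Val f 0 := by
  refine placeInf.congr (placeInf.mul placeInf.u_val hb) ?_ (by simp)
  have hT := T_ne
  rw [u_inf]; field_simp

lemma at_inf_aux (h : Sys s d s' d' x e z f) {e0 : ℂ} (he : placeInf.Val e e0)
    (hne : 1 - 4 * e0 ^ 2 ≠ 0) :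
    placeInf.Val x d ∧ placeInf.Val z d' ∧ placeInf.Val e 0 ∧ placeInf.Val f 0 ∧
      placeInf.Val (T * e * f) 0 := by
  have hx := reg_x h he (derInf he) hne
  obtain ⟨b, hb⟩ := reg_Te h ⟨_, hx⟩ ⟨_, he⟩
  have hf := val_of_T hb
  have hz := reg_x h.swap hf (derInf hf) (by simp)
  obtain ⟨b', hb'⟩ := reg_Te h.swap ⟨_, hz⟩ ⟨_, hf⟩
  have he' := val_of_T hb'
  obtain rfl := placeInf.uniq he he'
  exact ⟨placeInf.congr hx rfl (by simp), placeInf.congr hz rfl (by simp), he, hf,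
    placeInf.congr (placeInf.mul hb' hf) rfl (by simp)⟩

lemma at_inf (h : Sys s d s' d' x e z f) :
    placeInf.Val x d ∧ placeInf.Val z d' ∧ placeInf.Val e 0 ∧ placeInf.Val f 0 ∧
      placeInf.Val (T * e * f) 0 := by
  obtain ⟨e0, he⟩ := at_inf_e h
  obtain ⟨f0, hf⟩ := at_inf_e h.swap
  by_cases h1 : 1 - 4 * e0 ^ 2 = 0
  swap
  · exact at_inf_aux h he h1
  by_cases h2 : 1 - 4 * f0 ^ 2 = 0
  swap
  · obtain ⟨c1, c2, c3, c4, c5⟩ := at_inf_aux h.swap hf h2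
    exact ⟨c2, c1, c4, c3, placeInf.congr c5 (by ring) rfl⟩
  exfalso
  have he0 : e0 ≠ 0 := by rintro rfl; simp at h1
  have hf0 : f0 ≠ 0 := by rintro rfl; simp at h2
  rcases dich (pl := placeInf) x with hx | ⟨j, g, a, hg, ha, hx⟩
  · obtain ⟨b, hb⟩ := reg_Te h hx ⟨_, he⟩
    exact hf0 (placeInf.uniq hf (val_of_T hb))
  · have hT := T_ne
    have hu0 := placeInf.u_ne
    have hD := Dpole (pl := placeInf) g (j + 1)
    have hu : D placeInf.u = cc (-1) * placeInf.u := by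
      rw [u_inf, D_inv _ T_ne, D_T]; simp; field_simp
    rw [← hx, hu] at hD
    have hD' : D x * placeInf.u ^ (j + 1) = D g - (j + 1 : ℕ) * cc (-1) * g := by
      apply mul_right_cancel₀ hu0
      linear_combination hD
    have hx' : x * placeInf.u ^ (j + 1) = g := by rw [hx]; field_simp
    have hTu : T * placeInf.u = 1 := by rw [u_inf]; field_simp
    have h1 := h.h1
    have key : 2 * g ^ 2 * e + cc s * g * placeInf.u ^ (j + 1) -
        placeInf.u ^ (j + 1) * (D g - (j + 1 : ℕ) * cc (-1) * g) -
        2 * f * placeInf.u ^ (2 * j + 1) = 0 := by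
      rw [← hD', h1, ← hx']
      linear_combination 2 * f * placeInf.u ^ (2 * j + 1) * hTu
    have hv := sub (sub (placeInf.add (placeInf.mul (placeInf.mul two (pow hg 2)) he)
      (placeInf.mul (placeInf.mul (placeInf.const s) hg) (upow j)))
      (placeInf.mul (upow j) (sub (derInf hg) (placeInf.mul (placeInf.mul (num (j + 1))
        (placeInf.const (-1))) hg)))) (placeInf.mul (placeInf.mul two hf) (upow (2 * j)))
    rw [key] at hv
    have E := placeInf.uniq hv zero
    simp at E
    tauto

lemma at_inf_GG (h : Sys s d s' d' x e z f) :
    placeInf.Val (GG s d s' d' x e z f) (d ^ 2 + d' ^ 2) := by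
  obtain ⟨c1, c2, c3, c4, c5⟩ := at_inf h
  exact placeInf.congr (val_GG c1 c2 (placeInf.mul c1 c3) (placeInf.mul c2 c4) c5) rfl (by ring)

/-- Zero, the case of a pole of `e`. -/
lemma at_zero_pole (h : Sys s d s' d' x e z f) (hne : ¬ (placeAt 0).Reg e) :
    (placeAt 0).Val x 0 ∧ (placeAt 0).Val z d' ∧
    (placeAt 0).Val (GG s d s' d' x e z f) (d' ^ 2 - (1 - s) ^ 2) ∧
    (placeAt 0).Val (GG s' d' s d z f x e) (d' ^ 2 + 1 - s ^ 2) := by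
  rcases dich (pl := placeAt 0) e with he | ⟨k, g, a, hg, ha, he⟩
  · exact absurd he hne
  have hu : D (placeAt 0).u = cc 1 * (placeAt 0).u := by rw [u_at, u_zero]; simp
  obtain ⟨hh, m, hhv, hm, hx, hf⟩ := pole_0 h hu der0 hg ha he
  obtain ⟨m1, ⟨m0, hm1⟩, rfl⟩ := divis hm
  have hT := T_ne
  have hf' : (placeAt 0).Val f 0 := by
    refine (placeAt 0).congr ((placeAt 0).mul (upow k) hm1) ?_ (by simp)
    rw [u_zero] at hf ⊢
    apply mul_left_cancel₀ hT
    rw [hf]; ring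
  have hz := reg_x h.swap hf' (der0 hf') (by simp)
  obtain ⟨b, hb⟩ := reg_Te h.swap ⟨_, hz⟩ ⟨_, hf'⟩
  have hz' : (placeAt 0).Val z d' := (placeAt 0).congr hz rfl (by simp)
  have hx0 : (placeAt 0).Val x 0 := (placeAt 0).congr ((placeAt 0).mul (upow k) hhv) hx (by simp)
  rcases k with _ | k
  · have hP : (placeAt 0).Val (x * e) ((1 - s) / 2) := by
      refine (placeAt 0).congr ((placeAt 0).mul hhv hg) ?_ ?_
      · have := (placeAt 0).u_ne
        rw [hx, he]; field_simp
      · push_cast; field_simp; ring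
    have hQ := (placeAt 0).mul hz' hf'
    have hR := (placeAt 0).mul hb hf'
    refine ⟨hx0, hz', (placeAt 0).congr (val_GG hx0 hz' hP hQ
      ((placeAt 0).congr hR rfl (by simp))) rfl (by ring), (placeAt 0).congr (val_GG hz' hx0 hQ hP
      ((placeAt 0).congr hR (by ring) (by simp))) rfl (by ring)⟩
  · exfalso
    refine not_reg (k := k) hg ha ?_ ⟨b, hb⟩
    rw [he, u_zero]; field_simp; try ring

lemma at_zero_reg_x (h : Sys s d s' d' x e z f) {e0 f0 : ℂ} (he : (placeAt 0).Val e e0)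
    (hf : (placeAt 0).Val f f0) : ∃ x0, (placeAt 0).Val x x0 ∧ x0 * (2 * x0 * e0 + s) = 0 ∧
      x0 * (1 - 4 * e0 ^ 2) = 2 * s * e0 + d := by
  have hreg : (placeAt 0).Reg x := by
    by_cases h1 : 1 - 4 * e0 ^ 2 = 0
    swap
    · exact ⟨_, reg_x h he (der0 he) h1⟩
    rcases dich (pl := placeAt 0) x with hx | ⟨j, g, a, hg, ha, hx⟩
    · exact hx
    exfalso
    have he0 : e0 ≠ 0 := by rintro rfl; simp at h1
    have hT := T_ne
    have hD := Dpole (pl := placeAt 0) g (j + 1)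
    rw [← hx, u_at, u_zero] at hD
    rw [u_zero] at hx
    have hD' : D x * T ^ (j + 1) = D g - (j + 1 : ℕ) * g := by
      apply mul_right_cancel₀ hT
      linear_combination hD
    have hx' : x * T ^ (j + 1) = g := by rw [hx]; field_simp
    have h1 := h.h1
    have key : 2 * g ^ 2 * e + cc s * g * T ^ (j + 1) -
        T ^ (j + 1) * (D g - (j + 1 : ℕ) * g) -
        2 * f * T ^ (2 * j + 2 + 1) = 0 := by
      rw [← hD', h1, ← hx']; ring
    have hup := upow (pl := placeAt 0)
    rw [u_zero] at hup
    have hv := sub (sub ((placeAt 0).add ((placeAt 0).mul ((placeAt 0).mul two (pow hg 2)) he)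
      ((placeAt 0).mul ((placeAt 0).mul ((placeAt 0).const s) hg) (hup j)))
      ((placeAt 0).mul (hup j) (sub (der0 hg) ((placeAt 0).mul (num (j + 1))
         hg)))) ((placeAt 0).mul ((placeAt 0).mul two hf) (hup (2 * j + 2)))
    rw [key] at hv
    have E := (placeAt 0).uniq hv zero
    simp at E
    tauto
  obtain ⟨x0, hx⟩ := hreg
  refine ⟨x0, hx, ?_, ?_⟩
  · have h1 := h.h1
    have := sub ((placeAt 0).add ((placeAt 0).mul ((placeAt 0).mul two (pow hx 2)) he)
      ((placeAt 0).mul ((placeAt 0).const s) hx)) ((placeAt 0).mul ((placeAt 0).mul two (T_val 0)) hf)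
    rw [← h1] at this
    have E := (placeAt 0).uniq (der0 hx) this
    linear_combination -E
  · have h2 := h.h2
    have := sub (sub ((placeAt 0).mul hx (sub one ((placeAt 0).mul four (pow he 2))))
      ((placeAt 0).mul ((placeAt 0).mul two ((placeAt 0).const s)) he)) ((placeAt 0).const d)
    rw [← h2] at this
    have E := (placeAt 0).uniq ((placeAt 0).mul two (der0 he)) this
    linear_combination -E
end

/-- The residue theorem in the form we need. -/
lemma const_of_reg (f : RF) (h : ∀ c, (placeAt c).Reg f) (hi : placeInf.Reg f) : ∃ a, f = cc a := by
  have hd : f.denom.degree = 0 := by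
    by_contra hne
    obtain ⟨c, hc⟩ := IsAlgClosed.exists_root f.denom hne
    rw [IsRoot.def] at hc
    obtain ⟨a, p, q, h1, h2, h3⟩ := h c
    rw [← RatFunc.num_div_denom f, div_eq_div_iff (io_ne f.denom_ne_zero) (io_ne (ne_of_eval h1)),
      ← map_mul, ← map_mul, io_inj] at h2
    have := congrArg (Polynomial.eval c) h2
    simp only [eval_mul, hc, mul_zero, mul_eq_zero, h1, or_false] at this
    obtain ⟨r, t, hrt⟩ := RatFunc.isCoprime_num_denom f
    have h9 := congrArg (Polynomial.eval c) hrt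
    rw [eval_add, eval_mul, eval_mul, hc, this] at h9
    simp at h9
  have h1 : f.denom = 1 := by
    exact Polynomial.eq_one_of_monic_natDegree_zero (RatFunc.monic_denom f) (by
      rw [natDegree_eq_zero_iff_degree_le_zero, hd])
  have hf : f = io f.num := by
    conv_lhs => rw [← RatFunc.num_div_denom f, h1]
    simp
  obtain ⟨a, n, p, q, dp, dq, h2, h3, h4⟩ := hi
  rw [hf, eq_div_iff (io_ne (ne_of_coeff h2)), ← map_mul, io_inj] at h3
  have hq : q.natDegree = n := le_antisymm dq (le_natDegree_of_ne_zero h2)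
  have : f.num.natDegree = 0 := by
    by_contra hne
    have h0 : f.num ≠ 0 := by rintro h0; rw [h0] at hne; simp at hne
    have := congrArg natDegree h3
    rw [natDegree_mul h0 (ne_of_coeff h2)] at this
    omega
  refine ⟨f.num.coeff 0, ?_⟩
  rw [cc_eq, ← eq_C_of_natDegree_eq_zero this]
  exact hf

lemma reg_of_res {pl : Place} {g : RF} (h : pl.Val (g * pl.u) 0) : pl.Reg g := by
  obtain ⟨g', h1, h2⟩ := divis h
  rw [mul_comm] at h2
  rwa [mul_left_cancel₀ pl.u_ne h2]

lemma residue_aux (S : Finset ℂ) : ∀ (f : RF) (a b : ℂ),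
    (∀ c ∉ S, c ≠ 0 → (placeAt c).Reg f) →
    (∀ c, c ≠ 0 → ∃ n : ℤ, (placeAt c).Val (f * (placeAt c).u) (n * c)) →
    (placeAt 0).Val f a → placeInf.Val f b → ∃ n : ℤ, b - a = n := by
  induction S using Finset.induction_on with
  | empty =>
    intro f a b h1 _ h3 h4
    obtain ⟨v, rfl⟩ := const_of_reg f (fun c => by
      by_cases hc : c = 0
      · subst hc; exact ⟨_, h3⟩
      · exact h1 c (by simp) hc) ⟨_, h4⟩
    refine ⟨0, ?_⟩
    rw [placeInf.uniq h4 (placeInf.const v), (placeAt 0).uniq h3 ((placeAt 0).const v)]; simp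
  | insert c S hcS ih =>
    intro f a b h1 h2 h3 h4
    by_cases hc : c = 0
    · exact ih f a b (fun c' hc' h0 => h1 c' (by
        simp only [Finset.mem_insert, not_or]; exact ⟨fun h => h0 (h.trans hc), hc'⟩) h0) h2 h3 h4
    obtain ⟨n, hn⟩ := h2 c hc
    have hu := (placeAt c).u_ne
    set w : RF := cc (n * c) / (placeAt c).u with hw
    have hue : (placeAt c).u = T - cc c := rfl
    have hval : ∀ c' : ℂ, c' ≠ c → (placeAt c').Val w (n * c / (c' - c)) := fun c' hc' =>
      div ((placeAt c').const _) (sub (T_val c') ((placeAt c').const c)) (sub_ne_zero.2 hc')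
    have hres : (placeAt c).Val ((f - w) * (placeAt c).u) 0 := by
      refine (placeAt c).congr (sub hn ((placeAt c).const (n * c))) ?_ (by ring)
      rw [hw]; field_simp
    have hinf : placeInf.Val w 0 := by
      have h5 := sub (pl := placeInf) one (placeInf.mul (placeInf.const c) placeInf.u_val)
      refine placeInf.congr (div (placeInf.mul (placeInf.const (n * c)) placeInf.u_val) h5
        (by simp)) ?_ (by simp)
      have h6 := Val.ne h5 (by simp)
      have hT := T_ne
      rw [hw, div_eq_div_iff hu h6, u_inf, hue]; field_simp
    have hz := hval 0 (Ne.symm hc)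
    have hA : ∀ c' ∉ S, c' ≠ 0 → (placeAt c').Reg (f - w) := by
      intro c' hc' h0
      by_cases hcc : c' = c
      · subst hcc; exact reg_of_res hres
      · obtain ⟨v, hv⟩ := h1 c' (by simp [hcc, hc']) h0
        exact ⟨_, sub hv (hval c' hcc)⟩
    have hB : ∀ c', c' ≠ 0 →
        ∃ n : ℤ, (placeAt c').Val ((f - w) * (placeAt c').u) (n * c') := by
      intro c' h0
      by_cases hcc : c' = c
      · subst hcc; exact ⟨0, (placeAt c').congr hres rfl (by simp)⟩
      · obtain ⟨k, hk⟩ := h2 c' h0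
        exact ⟨k, (placeAt c').congr (sub hk ((placeAt c').mul (hval c' hcc) (placeAt c').u_val))
          (by ring) (by ring)⟩
    obtain ⟨m, hm⟩ := ih (f - w) _ _ hA hB (sub h3 hz) (sub h4 hinf)
    refine ⟨m + n, ?_⟩
    push_cast
    rw [← hm]; field_simp; ring

lemma residue (f : RF) (a b : ℂ)
    (h : ∀ c, c ≠ 0 → ∃ n : ℤ, (placeAt c).Val (f * (placeAt c).u) (n * c))
    (h3 : (placeAt 0).Val f a) (h4 : placeInf.Val f b) : ∃ n : ℤ, b - a = n := by
  refine residue_aux f.denom.roots.toFinset f a b ?_ h h3 h4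
  intro c hc _
  have : f.denom.eval c ≠ 0 := by
    intro h0; apply hc; rw [Multiset.mem_toFinset, mem_roots f.denom_ne_zero]; exact h0
  exact ⟨_, f.num, f.denom, this, (RatFunc.num_div_denom f).symm, (div_mul_cancel₀ _ this).symm⟩

section
variable {s d s' d' : ℂ} {x e z f : RF}

/-- First Bäcklund transformation. -/
lemma Sys.B1 (h : Sys s d s' d' x e z f) (hne : 2 * e + 1 ≠ 0) :
    Sys d s s' d' (x + cc (s - d) / (2 * e + 1)) e z f := by
  have h1 := h.h1
  have h2 := h.h2
  have hDD : D (2 * e + 1) = x * (1 - 4 * e ^ 2) - 2 * cc s * e - cc d := by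
    rw [map_add, Derivation.map_one_eq_zero, D_mul, ← h2, show (2 : RF) = ((2 : ℕ) : RF) by simp,
      Derivation.map_natCast]
    ring
  refine ⟨?_, ?_, h.h3, h.h4⟩
  · rw [map_add, D_div _ _ hne, D_cc, hDD, h1, map_sub]
    field_simp
    ring
  · have hr := div_mul_cancel₀ (cc (s - d)) hne
    rw [h2]
    linear_combination (2 * e - 1) * hr - (1 - 2 * e) * (map_sub cc s d)

lemma Sys.B1_deg (h : Sys s d s' d' x e z f) (hne : 2 * e + 1 = 0) : s = d := by
  have h2 := h.h2
  have hDD : 2 * D e = 0 := by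
    have : D (2 * e + 1) = 0 := by rw [hne, map_zero]
    rw [map_add, Derivation.map_one_eq_zero, D_mul, show (2 : RF) = ((2 : ℕ) : RF) by simp,
      Derivation.map_natCast] at this
    push_cast at this
    linear_combination this
  have : cc s = cc d := by
    linear_combination hDD - h2 - (x * (1 - 2 * e) - cc s) * hne
  exact cc.injective this

/-- Second Bäcklund transformation. -/
lemma Sys.B2 (h : Sys s d s' d' x e z f) (hne : x * z - T ≠ 0) :
    Sys (1 - s') d (1 - s) d' x (e - cc ((1 - s - s') / 2) * z / (x * z - T)) z
      (f - cc ((1 - s - s') / 2) * x / (x * z - T)) := by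
  have h1 := h.h1
  have h2 := h.h2
  have h3 := h.h3
  have h4 := h.h4
  obtain ⟨a, ha⟩ : ∃ a, a = (1 - s - s') / 2 := ⟨_, rfl⟩
  rw [← ha]
  have hs' : s' = 1 - s - 2 * a := by rw [ha]; ring
  subst hs'
  have e2 : cc 2 = 2 := map_ofNat cc 2
  have e3 : cc (1 - (1 - s - 2 * a)) = cc s + 2 * cc a := by
    rw [← e2, ← map_mul, ← map_add]; congr 1; ring
  have e4 : cc (1 - s - 2 * a) = 1 - cc s - 2 * cc a := by
    rw [map_sub, map_sub, map_mul, e2, map_one]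
  have hDD : D (x * z - T) = x * D z + z * D x - T := by rw [map_sub, D_mul, D_T]
  rw [e4] at h3 h4
  obtain ⟨W, hW⟩ : ∃ W, W = x * z - T := ⟨_, rfl⟩
  have hT : T = x * z - W := by rw [hW]; ring
  rw [← hW] at hDD hne ⊢
  refine ⟨?_, ?_, ?_, ?_⟩
  · rw [h1, e3, hT]; field_simp; ring
  · rw [map_sub, D_div _ _ hne, hDD, D_mul, D_cc, h1, h3, mul_sub, h2, e3, hT]; field_simp; ring
  · rw [h3, map_sub, map_one, hT]; field_simp; ring
  · rw [map_sub, D_div _ _ hne, hDD, D_mul, D_cc, h1, h3, mul_sub, h4, map_sub, map_one, hT]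
    field_simp; ring

lemma Sys.B2_deg (h : Sys s d s' d' x e z f) (hne : x * z - T = 0) : 1 - s' = s := by
  have h1 := h.h1
  have h3 := h.h3
  have hDD : x * D z + z * D x - T = 0 := by
    rw [← map_zero D, ← hne, map_sub, D_mul, D_T]
  have hT := T_ne
  have : cc (1 - s') = cc s := by
    rw [h1, h3] at hDD
    apply mul_right_cancel₀ hT
    rw [map_sub, map_one]
    linear_combination -hDD + (2 * x * e + 2 * z * f + cc s + cc s') * hne
  exact cc.injective this
end

def Ev (a : ℂ) : Prop := ∃ k : ℤ, a = 2 * k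
def Od (a : ℂ) : Prop := ∃ k : ℤ, a = 2 * k + 1

lemma Ev.neg {a : ℂ} : Ev a → Ev (-a) := by
  rintro ⟨k, rfl⟩; exact ⟨-k, by push_cast; ring⟩
lemma Od.neg {a : ℂ} : Od a → Od (-a) := by
  rintro ⟨k, rfl⟩; exact ⟨-k - 1, by push_cast; ring⟩
lemma Ev.one_sub {a : ℂ} : Ev a → Od (1 - a) := by
  rintro ⟨k, rfl⟩; exact ⟨-k, by push_cast; ring⟩
lemma Od.one_sub {a : ℂ} : Od a → Ev (1 - a) := by
  rintro ⟨k, rfl⟩; exact ⟨-k, by push_cast; ring⟩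
lemma Ev_one_sub {a : ℂ} : Ev (1 - a) ↔ Od a :=
  ⟨fun h => by simpa using h.one_sub, Od.one_sub⟩
lemma Od_one_sub {a : ℂ} : Od (1 - a) ↔ Ev a :=
  ⟨fun h => by simpa using h.one_sub, Ev.one_sub⟩
lemma Ev_neg {a : ℂ} : Ev (-a) ↔ Ev a :=
  ⟨fun h => by simpa using h.neg, Ev.neg⟩
lemma Od_neg {a : ℂ} : Od (-a) ↔ Od a :=
  ⟨fun h => by simpa using h.neg, Od.neg⟩

/-- The arithmetic condition: one of the entries is even and another one is odd. -/
def Cond (s d s' d' : ℂ) : Prop :=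
  (Ev d ∨ Ev s ∨ Od s' ∨ Od d') ∧ (Od d ∨ Od s ∨ Ev s' ∨ Ev d')

lemma Cond.B1 {s d s' d' : ℂ} (h : Cond d s s' d') : Cond s d s' d' := by
  unfold Cond at *; tauto
lemma Cond.swap {s d s' d' : ℂ} (h : Cond s' d' s d) : Cond s d s' d' := by
  unfold Cond at *; tauto
lemma Cond.neg {s d s' d' : ℂ} (h : Cond s (-d) s' (-d')) : Cond s d s' d' := by
  unfold Cond at *; rw [Ev_neg, Od_neg, Ev_neg, Od_neg] at h; exact h

lemma int_cases {a : ℂ} (h : ∃ n : ℤ, a = n) : Ev a ∨ Od a := by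
  obtain ⟨n, rfl⟩ := h
  rcases Int.even_or_odd' n with ⟨k, h | h⟩
  · exact Or.inl ⟨k, by rw [h]; push_cast; ring⟩
  · exact Or.inr ⟨k, by rw [h]; push_cast; ring⟩

section
variable {s d s' d' : ℂ} {x e z f : RF}

lemma int_x (h : Sys s d s' d' x e z f) {x0 : ℂ} (hx : (placeAt 0).Val x x0) :
    ∃ n : ℤ, d - x0 = n :=
  residue x x0 d (fun c hc => res_c h hc (u_at c) (T_val c)) hx (at_inf h).1

lemma int_G (h : Sys s d s' d' x e z f) {x0 g0 : ℂ} (hx : (placeAt 0).Val x x0)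
    (hg : (placeAt 0).Val (GG s d s' d' x e z f) g0) :
    ∃ n : ℤ, d ^ 2 + d' ^ 2 + 2 * d - (g0 + 2 * x0) = 4 * n := by
  obtain ⟨n, hn⟩ := residue (cc (1 / 4) * (GG s d s' d' x e z f + 2 * x)) _ _
    (fun c hc => by
      obtain ⟨n, hn⟩ := res_G h hc (u_at c) (T_val c)
      exact ⟨n, (placeAt c).congr ((placeAt c).mul ((placeAt c).const (1 / 4)) hn)
        (by ring) (by ring)⟩)
    ((placeAt 0).mul ((placeAt 0).const (1 / 4)) ((placeAt 0).add hg ((placeAt 0).mul two hx)))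
    (placeInf.mul (placeInf.const (1 / 4)) (placeInf.add (at_inf_GG h)
      (placeInf.mul two (at_inf h).1)))
  exact ⟨n, by rw [← hn]; ring⟩

lemma cond_pole (h : Sys s d s' d' x e z f) (hne : ¬ (placeAt 0).Reg e) : Cond s d s' d' := by
  obtain ⟨h1, h2, h3, h4⟩ := at_zero_pole h hne
  obtain ⟨n, hn⟩ := int_x h h1
  obtain ⟨N1, hN1⟩ := int_G h h1 h3
  obtain ⟨N2, hN2⟩ := int_G h.swap h2 h4
  have hs : s = d + 1 - 2 * ((N1 - N2 : ℤ) : ℂ) := by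
    push_cast; linear_combination (-1/2) * hN1 + (1/2) * hN2
  generalize N1 - N2 = k at hs
  rcases int_cases (a := d) ⟨n, by rw [← hn]; ring⟩ with ⟨m, hm⟩ | ⟨m, hm⟩
  · exact ⟨Or.inl ⟨m, hm⟩, Or.inr (Or.inl ⟨m - k, by rw [hs, hm]; push_cast; ring⟩)⟩
  · exact ⟨Or.inr (Or.inl ⟨m + 1 - k, by rw [hs, hm]; push_cast; ring⟩), Or.inl ⟨m, hm⟩⟩

lemma cond_00 (h : Sys s d s' d' x e z f) (he : (placeAt 0).Reg e) (hf : (placeAt 0).Reg f)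
    (hx : (placeAt 0).Val x 0) (hz : (placeAt 0).Val z 0) : Cond s d s' d' := by
  obtain ⟨e0, he⟩ := he
  obtain ⟨f0, hf⟩ := hf
  have hP := (placeAt 0).mul hx he
  have hQ := (placeAt 0).mul hz hf
  have hR := (placeAt 0).mul ((placeAt 0).mul (T_val 0) he) hf
  have hR' := (placeAt 0).mul ((placeAt 0).mul (T_val 0) hf) he
  obtain ⟨n, hn⟩ := int_x h hx
  obtain ⟨N1, hN1⟩ := int_G h hx (val_GG hx hz hP hQ ((placeAt 0).congr hR rfl (by simp)))
  obtain ⟨N2, hN2⟩ := int_G h.swap hz (val_GG hz hx hQ hP ((placeAt 0).congr hR' rfl (by simp)))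
  have hs : d = d' + 2 * ((N1 - N2 : ℤ) : ℂ) := by
    push_cast; linear_combination (1/2) * hN1 - (1/2) * hN2
  generalize N1 - N2 = k at hs
  have hs' : d' = d - 2 * k := by rw [hs]; ring
  rcases int_cases (a := d) ⟨n, by rw [← hn]; ring⟩ with ⟨m, hm⟩ | ⟨m, hm⟩
  · exact ⟨Or.inl ⟨m, hm⟩, Or.inr (Or.inr (Or.inr ⟨m - k, by rw [hs', hm]; push_cast; ring⟩))⟩
  · exact ⟨Or.inr (Or.inr (Or.inr ⟨m - k, by rw [hs', hm]; push_cast; ring⟩)), Or.inl ⟨m, hm⟩⟩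

lemma red1 (h : Sys s d s' d' x e z f) {e0 x0 : ℂ} (he : (placeAt 0).Val e e0)
    (hx : (placeAt 0).Val x x0) (hs : x0 * (2 * e0 + 1) = x0 - s) (hd : x0 = d) (hsd : s ≠ d) :
    ∃ x1, Sys d s s' d' x1 e z f ∧ (placeAt 0).Val x1 0 := by
  have hne : 2 * e0 + 1 ≠ 0 := by
    intro h0; rw [h0] at hs; apply hsd; linear_combination hd + hs
  have hv := (placeAt 0).add ((placeAt 0).mul two he) one
  have hne' := Val.ne hv hne
  refine ⟨_, h.B1 hne', (placeAt 0).congr ((placeAt 0).add hx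
    (div ((placeAt 0).const (s - d)) hv hne)) rfl ?_⟩
  field_simp
  linear_combination -hs - hd

lemma red (h : Sys s d s' d' x e z f) (he : (placeAt 0).Reg e) (hf : (placeAt 0).Reg f) :
    ∃ s1 d1 d1' x1 e1 z1 f1, Sys s1 d1 s' d1' x1 e1 z1 f1 ∧ (placeAt 0).Reg e1 ∧
      (placeAt 0).Reg f1 ∧ (placeAt 0).Val x1 0 ∧ ((placeAt 0).Val z 0 → (placeAt 0).Val z1 0) ∧
      (Cond s1 d1 s' d1' → Cond s d s' d') := by
  obtain ⟨e0, he⟩ := he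
  obtain ⟨f0, hf⟩ := hf
  obtain ⟨x0, hx, E1, E2⟩ := at_zero_reg_x h he hf
  by_cases hx0 : x0 = 0
  · subst hx0
    exact ⟨s, d, d', x, e, z, f, h, ⟨_, he⟩, ⟨_, hf⟩, hx, id, id⟩
  have hs : 2 * x0 * e0 + s = 0 := (mul_eq_zero.1 E1).resolve_left hx0
  have hd : x0 = d := by linear_combination E2 + 2 * e0 * hs
  by_cases hsd : s = d
  · have hsd' : s ≠ -d := by
      intro h0; apply hx0; rw [hd]; linear_combination (1/2) * h0 - (1/2) * hsd
    obtain ⟨x1, hx1, hv⟩ := red1 h.neg (neg he) (neg hx) (by linear_combination hs) (by rw [hd]) hsd'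
    exact ⟨-d, s, -d', x1, -e, -z, -f, hx1, ⟨_, neg he⟩, ⟨_, neg hf⟩, hv,
      fun hz => (placeAt 0).congr (neg hz) rfl (by simp), fun hc => hc.B1.neg⟩
  · obtain ⟨x1, hx1, hv⟩ := red1 h he hx (by linear_combination hs) hd hsd
    exact ⟨d, s, d', x1, e, z, f, hx1, ⟨_, he⟩, ⟨_, hf⟩, hv, id, fun hc => hc.B1⟩

theorem necessity (h : Sys s d s' d' x e z f) : Cond s d s' d' := by
  by_cases he : (placeAt 0).Reg e
  swap
  · exact cond_pole h he
  by_cases hf : (placeAt 0).Reg f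
  swap
  · exact (cond_pole h.swap hf).swap
  obtain ⟨s1, d1, d1', x1, e1, z1, f1, h1, he1, hf1, hx1, -, C1⟩ := red h he hf
  apply C1
  obtain ⟨s2, d2, d2', x2, e2, z2, f2, h2, he2, hf2, hx2, hz2, C2⟩ := red h1.swap hf1 he1
  exact (C2 (cond_00 h2 he2 hf2 hx2 (hz2 hx1))).swap
end

/-- Existence of a rational solution, in terms of the vector of parameters. -/
def Has (v1 v2 v3 v4 : ℂ) : Prop := ∃ x e z f, Sys v2 v1 (1 - v3) (1 - v4) x e z f

section
variable {a b c d : ℂ}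

lemma Has.p12 (h : Has a b c d) : Has b a c d := by
  obtain ⟨x, e, z, f, h⟩ := h
  by_cases hne : 2 * e + 1 = 0
  · have := h.B1_deg hne
    subst this
    exact ⟨x, e, z, f, h⟩
  · exact ⟨_, _, _, _, h.B1 hne⟩

lemma Has.p34 (h : Has a b c d) : Has a b d c := by
  obtain ⟨x, e, z, f, h⟩ := h
  by_cases hne : 2 * f + 1 = 0
  · have := h.swap.B1_deg hne
    have hcd : c = d := by linear_combination -this
    subst hcd
    exact ⟨x, e, z, f, h⟩
  · exact ⟨_, _, _, _, (h.swap.B1 hne).swap⟩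

lemma Has.p23 (h : Has a b c d) : Has a c b d := by
  obtain ⟨x, e, z, f, h⟩ := h
  by_cases hne : x * z - T = 0
  · have := h.B2_deg hne
    have hcd : c = b := by linear_combination this
    subst hcd
    exact ⟨x, e, z, f, h⟩
  · have := h.B2 hne
    rw [sub_sub_cancel] at this
    exact ⟨_, _, _, _, this⟩

lemma Has.p13 (h : Has a b c d) : Has c b a d := h.p12.p23.p12
lemma Has.p24 (h : Has a b c d) : Has a d c b := h.p23.p34.p23
lemma Has.p14 (h : Has a b c d) : Has d b c a := h.p12.p24.p12

lemma Has.n14 (h : Has a b c d) : Has (-a) b c (2 - d) := by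
  obtain ⟨x, e, z, f, h⟩ := h
  have := h.neg
  rw [show -(1 - d) = 1 - (2 - d) by ring] at this
  exact ⟨_, _, _, _, this⟩

lemma Has.n12 (h : Has a b c d) : Has (-a) (2 - b) c d := h.p24.n14.p24
lemma Has.n21 (h : Has a b c d) : Has (2 - a) (-b) c d := h.p12.n12.p12

lemma Has.up (h : Has a b c d) : Has (a + 2) (b - 2) c d := by
  have := h.n12.n21
  rwa [show 2 - -a = a + 2 by ring, show -(2 - b) = b - 2 by ring] at this

lemma Has.down (h : Has a b c d) : Has (a - 2) (b + 2) c d := by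
  have := h.n21.n12
  rwa [show 2 - -b = b + 2 by ring, show -(2 - a) = a - 2 by ring] at this

lemma Has.shift (h : Has a b c d) (k : ℤ) : Has (a + 2 * k) (b - 2 * k) c d := by
  induction k using Int.induction_on with
  | zero => simpa using h
  | succ i ih =>
    have := ih.up
    convert this using 1 <;> push_cast <;> ring
  | pred i ih =>
    have := ih.down
    convert this using 1 <;> push_cast <;> ring

lemma Has.base : Has 0 b c 1 := by
  refine ⟨0, 0, 0, 0, ?_⟩
  constructor <;> simp

lemma Has.main (h1 : Ev a) (h4 : Od d) : Has a b c d := by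
  obtain ⟨k, rfl⟩ := h1
  obtain ⟨m, rfl⟩ := h4
  have h := (Has.base (b := b + 2 * k) (c := c + 2 * m)).shift k
  have h' := (h.p14.p23.shift m).p23.p14
  convert h' using 1 <;> ring

lemma Ev.not_Od (h : Ev a) (h' : Od a) : False := by
  obtain ⟨k, rfl⟩ := h
  obtain ⟨m, hm⟩ := h'
  have : (2 * k : ℤ) = 2 * m + 1 := by exact_mod_cast hm
  omega

lemma Has.of_cond (h : (Ev a ∨ Ev b ∨ Ev c ∨ Ev d) ∧ (Od a ∨ Od b ∨ Od c ∨ Od d)) :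
    Has a b c d := by
  obtain ⟨h1 | h1 | h1 | h1, h2 | h2 | h2 | h2⟩ := h
  · exact (h1.not_Od h2).elim
  · exact (Has.main h1 h2).p24
  · exact (Has.main h1 h2).p34
  · exact Has.main h1 h2
  · exact (Has.main h1 h2).p24.p12
  · exact (h1.not_Od h2).elim
  · exact (Has.main h1 h2).p34.p12
  · exact (Has.main h1 h2).p12
  · exact (Has.main h1 h2).p34.p13
  · exact (Has.main h1 h2).p24.p13
  · exact (h1.not_Od h2).elim
  · exact (Has.main h1 h2).p13
  · exact (Has.main h1 h2).p14
  · exact (Has.main h1 h2).p24.p14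
  · exact (Has.main h1 h2).p34.p14
  · exact (h1.not_Od h2).elim
end

theorem sufficiency {s d s' d' : ℂ} (h : Cond s d s' d') : ∃ x e z f, Sys s d s' d' x e z f := by
  have := Has.of_cond (a := d) (b := s) (c := 1 - s') (d := 1 - d')
    (by rw [Ev_one_sub, Ev_one_sub, Od_one_sub, Od_one_sub]; exact h)
  unfold Has at this
  simpa only [sub_sub_cancel] using this

/-- `F` is the rational function whose values are almost everywhere those of `f`. -/
def RRep (F : RF) (f : ℂ → ℂ) : Prop :=
  ∃ p q : ℂ[X], q ≠ 0 ∧ F = io p / io q ∧ ∀ᶠ t in cofinite, f t = p.eval t / q.eval t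

lemma ev_ne {q : ℂ[X]} (hq : q ≠ 0) : ∀ᶠ t in cofinite, q.eval t ≠ 0 := by
  rw [eventually_cofinite]
  refine (q.roots.toFinset.finite_toSet).subset ?_
  intro t ht
  simp only [ne_eq, not_not, Set.mem_setOf_eq] at ht
  simp [hq, ht]

lemma RRep.add {F G : RF} {f g : ℂ → ℂ} (hF : RRep F f) (hG : RRep G g) :
    RRep (F + G) (fun t => f t + g t) := by
  obtain ⟨p, q, hq, rfl, h⟩ := hF
  obtain ⟨p', q', hq', rfl, h'⟩ := hG
  refine ⟨p * q' + q * p', q * q', mul_ne_zero hq hq', ?_, ?_⟩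
  · rw [div_add_div _ _ (io_ne hq) (io_ne hq')]; simp
  · filter_upwards [h, h', ev_ne hq, ev_ne hq'] with t h1 h2 h3 h4
    rw [h1, h2, div_add_div _ _ h3 h4]; simp

lemma RRep.mul {F G : RF} {f g : ℂ → ℂ} (hF : RRep F f) (hG : RRep G g) :
    RRep (F * G) (fun t => f t * g t) := by
  obtain ⟨p, q, hq, rfl, h⟩ := hF
  obtain ⟨p', q', hq', rfl, h'⟩ := hG
  refine ⟨p * p', q * q', mul_ne_zero hq hq', ?_, ?_⟩
  · rw [div_mul_div_comm]; simp
  · filter_upwards [h, h'] with t h1 h2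
    rw [h1, h2, div_mul_div_comm]; simp

lemma RRep.const (a : ℂ) : RRep (cc a) (fun _ => a) :=
  ⟨Polynomial.C a, 1, one_ne_zero, by rw [cc_eq]; simp, by simp⟩

lemma RRep.T : RRep T (fun t => t) := ⟨X, 1, one_ne_zero, by simp [_root_.T], by simp⟩

lemma RRep.eq_iff {F G : RF} {f g : ℂ → ℂ} (hF : RRep F f) (hG : RRep G g) :
    F = G ↔ ∀ᶠ t in cofinite, f t = g t := by
  obtain ⟨p, q, hq, rfl, h⟩ := hF
  obtain ⟨p', q', hq', rfl, h'⟩ := hG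
  rw [div_eq_div_iff (io_ne hq) (io_ne hq'), ← map_mul, ← map_mul, io_inj]
  constructor
  · intro E
    filter_upwards [h, h', ev_ne hq, ev_ne hq'] with t h1 h2 h3 h4
    rw [h1, h2, div_eq_div_iff h3 h4, ← eval_mul, ← eval_mul, E]
  · intro E
    apply Polynomial.eq_of_infinite_eval_eq
    have : ∀ᶠ t in cofinite, eval t (p * q') = eval t (p' * q) := by
      filter_upwards [h, h', ev_ne hq, ev_ne hq', E] with t h1 h2 h3 h4 h5
      rw [eval_mul, eval_mul, ← div_eq_div_iff h3 h4, ← h1, ← h2, h5]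
    rw [eventually_cofinite] at this
    have h9 := this.infinite_compl
    convert h9 using 1
    ext t; simp

lemma RRep.D {F : RF} {f : ℂ → ℂ} {p q : ℂ[X]} (hq : q ≠ 0) (hF : F = io p / io q)
    (hf : ∀ t, f t = p.eval t / q.eval t) : RRep (D F) (fun t => t * deriv f t) := by
  subst hF
  have e : f = fun t => p.eval t / q.eval t := funext hf
  refine ⟨X * (derivative p * q - p * derivative q), q ^ 2, pow_ne_zero _ hq, ?_, ?_⟩
  · rw [D_apply, Dn_div _ _ hq]; simp
  · filter_upwards [ev_ne hq] with t ht
    rw [e, ((p.hasDerivAt t).fun_div (q.hasDerivAt t) ht).deriv]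
    simp
    ring

/-- The original system, for elements of the field of rational functions. -/
structure OSys (a0 a1 a3 a4 : ℂ) (x y z w : RF) : Prop where
  h1 : D x = cc 2 * (x * x) * y + cc (-1) * (x * x) + cc (a0 + a1) * x + cc (-2) * w + T
  h2 : D y = cc (-2) * x * (y * y) + cc 2 * x * y + cc (-(a0 + a1)) * y + cc a1
  h3 : D z = cc 2 * (z * z) * w + cc (-1) * T * (z * z) + cc (-(1 - a3 - a4)) * z + cc 1 +
    cc (-2) * y
  h4 : D w = cc (-2) * z * (w * w) + cc 2 * T * z * w + cc (1 - a3 - a4) * w + cc a3 * T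

/-- An exact representation of a function as a rational function. -/
def ERep (F : RF) (f : ℂ → ℂ) : Prop :=
  ∃ p q : ℂ[X], q ≠ 0 ∧ F = io p / io q ∧ ∀ t, f t = p.eval t / q.eval t

lemma ERep.rep {F : RF} {f : ℂ → ℂ} (h : ERep F f) : RRep F f := by
  obtain ⟨p, q, h1, h2, h3⟩ := h
  exact ⟨p, q, h1, h2, Eventually.of_forall h3⟩

lemma ERep.D {F : RF} {f : ℂ → ℂ} (h : ERep F f) : RRep (D F) (fun t => t * deriv f t) := by
  obtain ⟨p, q, h1, h2, h3⟩ := h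
  exact RRep.D h1 h2 h3

lemma OSys_iff {a0 a1 a2 a3 a4 : ℂ} {x y z w : RF} {x' y' z' w' : ℂ → ℂ} (hx : ERep x x')
    (hy : ERep y y') (hz : ERep z z') (hw : ERep w w') :
    OSys a0 a1 a3 a4 x y z w ↔ ∀ᶠ t in cofinite, D4Eqs a0 a1 a2 a3 a4 x' y' z' w' t := by
  have C := RRep.const
  have tt := RRep.T
  have rx := hx.rep
  have ry := hy.rep
  have rz := hz.rep
  have rw' := hw.rep
  have E1 := RRep.eq_iff hx.D (((((((C 2).mul (rx.mul rx)).mul ry).add ((C (-1)).mul (rx.mul rx))).add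
    ((C (a0 + a1)).mul rx)).add ((C (-2)).mul rw')).add tt)
  have E2 := RRep.eq_iff hy.D ((((((C (-2)).mul rx).mul (ry.mul ry)).add (((C 2).mul rx).mul ry)).add
    ((C (-(a0 + a1))).mul ry)).add (C a1))
  have E3 := RRep.eq_iff hz.D (((((((C 2).mul (rz.mul rz)).mul rw').add (((C (-1)).mul tt).mul
    (rz.mul rz))).add ((C (-(1 - a3 - a4))).mul rz)).add (C 1)).add ((C (-2)).mul ry))
  have E4 := RRep.eq_iff hw.D ((((((C (-2)).mul rz).mul (rw'.mul rw')).add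
    ((((C 2).mul tt).mul rz).mul rw')).add ((C (1 - a3 - a4)).mul rw')).add ((C a3).mul tt))
  constructor
  · rintro ⟨h1, h2, h3, h4⟩
    filter_upwards [E1.1 h1, E2.1 h2, E3.1 h3, E4.1 h4] with t k1 k2 k3 k4
    refine ⟨?_, ?_, ?_, ?_⟩
    · rw [k1]; ring
    · rw [k2]; ring
    · rw [k3]; ring
    · rw [k4]; ring
  · intro h
    refine ⟨E1.2 ?_, E2.2 ?_, E3.2 ?_, E4.2 ?_⟩
    · filter_upwards [h] with t k
      rw [k.1]; ring
    · filter_upwards [h] with t k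
      rw [k.2.1]; ring
    · filter_upwards [h] with t k
      rw [k.2.2.1]; ring
    · filter_upwards [h] with t k
      rw [k.2.2.2]; ring

lemma ERep.isRatFn {F : RF} {f : ℂ → ℂ} (h : ERep F f) : IsRatFn f := by
  obtain ⟨p, q, h1, _, h3⟩ := h
  exact ⟨p, q, h1, h3⟩

lemma IsRatFn.eRep {f : ℂ → ℂ} (h : IsRatFn f) : ∃ F, ERep F f := by
  obtain ⟨p, q, h1, h3⟩ := h
  exact ⟨_, p, q, h1, rfl, h3⟩

lemma exists_fn (F : RF) : ∃ f, ERep F f := by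
  obtain ⟨p, q, h1, h3⟩ := rep F
  exact ⟨fun t => p.eval t / q.eval t, p, q, h1, h3, fun _ => rfl⟩

lemma sol_iff (a0 a1 a2 a3 a4 : ℂ) :
    (∃ x y z w : ℂ → ℂ, IsRatSolD4 a0 a1 a2 a3 a4 x y z w) ↔
      ∃ x y z w : RF, OSys a0 a1 a3 a4 x y z w := by
  constructor
  · rintro ⟨x, y, z, w, hx, hy, hz, hw, S, hS, h⟩
    obtain ⟨X, hX⟩ := hx.eRep
    obtain ⟨Y, hY⟩ := hy.eRep
    obtain ⟨Z, hZ⟩ := hz.eRep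
    obtain ⟨W, hW⟩ := hw.eRep
    refine ⟨X, Y, Z, W, (OSys_iff (a2 := a2) hX hY hZ hW).2 ?_⟩
    rw [eventually_cofinite]
    refine hS.subset fun t ht => ?_
    by_contra h0
    exact ht (h t h0)
  · rintro ⟨X, Y, Z, W, h⟩
    obtain ⟨x, hx⟩ := exists_fn X
    obtain ⟨y, hy⟩ := exists_fn Y
    obtain ⟨z, hz⟩ := exists_fn Z
    obtain ⟨w, hw⟩ := exists_fn W
    refine ⟨x, y, z, w, hx.isRatFn, hy.isRatFn, hz.isRatFn, hw.isRatFn, _,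
      eventually_cofinite.1 ((OSys_iff (a2 := a2) hx hy hz hw).1 h), fun t ht => ?_⟩
    simpa using ht

lemma cc_half : 2 * cc (1 / 2) = 1 := by
  rw [← map_ofNat cc 2, ← map_mul]; norm_num

lemma osys_sys {a0 a1 a3 a4 : ℂ} {x y z w : RF} (h : OSys a0 a1 a3 a4 x y z w) :
    Sys (a0 + a1) (a0 - a1) (a3 + a4) (a4 - a3) x (y - cc (1 / 2)) (T * z)
      (w / T - cc (1 / 2)) := by
  have h1 := h.h1
  have h2 := h.h2
  have h3 := h.h3
  have h4 := h.h4
  have hT := T_ne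
  have hh := cc_half
  have e2 : cc 2 = 2 := map_ofNat cc 2
  simp only [map_neg, map_add, map_sub, map_one, e2] at h1 h2 h3 h4
  obtain ⟨r, hr⟩ : ∃ r, r = w / T := ⟨_, rfl⟩
  have hw : w = T * r := by rw [hr]; field_simp
  have hDw : D w = T * D r + r * T := by rw [hw, D_mul, D_T]
  rw [← hr]
  generalize hk : cc (1 / 2) = k at *
  have hkk : D k = 0 := by rw [← hk, D_cc]
  refine ⟨?_, ?_, ?_, ?_⟩ <;> simp only [map_add, map_sub, hkk, D_mul, D_T]
  · rw [h1, hw]; linear_combination (x ^ 2 - T) * hh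
  · rw [h2]; linear_combination (x * (2 * k + 1 - 4 * y) - cc a0 - cc a1) * hh
  · rw [h3, hw]; linear_combination (T ^ 2 * z ^ 2 - T) * hh
  · apply mul_left_cancel₀ hT
    have : T * D r = D w - r * T := by rw [hDw]; ring
    linear_combination 2 * this + 2 * h4 + (-4 * z * (w + T * r) + 4 * T * z + 2 * (1 - cc a3 - cc a4)) * hw + T * (T * z * (2 * k + 1 - 4 * r) - cc a3 - cc a4) * hh

lemma sys_osys {a0 a1 a3 a4 : ℂ} {x e z f : RF}
    (h : Sys (a0 + a1) (a0 - a1) (a3 + a4) (a4 - a3) x e z f) :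
    OSys a0 a1 a3 a4 x (e + cc (1 / 2)) (z / T) (T * (f + cc (1 / 2))) := by
  have h1 := h.h1
  have h2 := h.h2
  have h3 := h.h3
  have h4 := h.h4
  have hT := T_ne
  have hh := cc_half
  have e2 : cc 2 = 2 := map_ofNat cc 2
  obtain ⟨r, hr⟩ : ∃ r, r = z / T := ⟨_, rfl⟩
  have hw : z = T * r := by rw [hr]; field_simp
  have hDw : D z = T * D r + r * T := by rw [hw, D_mul, D_T]
  rw [← hr]
  rw [hDw, hw] at h3
  rw [hw] at h4
  generalize hk : cc (1 / 2) = k at *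
  have hkk : D k = 0 := by rw [← hk, D_cc]
  simp only [map_add, map_sub] at h1 h2 h3 h4
  have two_ne : (2 : RF) ≠ 0 := two_ne_zero
  refine ⟨?_, ?_, ?_, ?_⟩ <;> simp only [map_neg, map_add, map_sub, map_one, e2, hkk, D_mul, D_T]
  · linear_combination h1 + (T - x ^ 2) * hh
  · apply mul_left_cancel₀ two_ne
    linear_combination h2 + (x * (2 * k - 1 + 4 * e) + cc a0 + cc a1) * hh
  · apply mul_left_cancel₀ hT
    linear_combination h3 + (T - T ^ 2 * r ^ 2) * hh
  · apply mul_left_cancel₀ two_ne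
    linear_combination T * h4 + T * (T * r * (2 * k - 1 + 4 * f) + cc a3 + cc a4) * hh

lemma same_iff {a b : ℂ} : ((∃ m : ℤ, a = m) ∧ (∃ m : ℤ, b = m) ∧ (∃ k : ℤ, a - b = 2 * k)) ↔
    (Ev a ∧ Ev b) ∨ (Od a ∧ Od b) := by
  constructor
  · rintro ⟨h1, -, k, hk⟩
    have hb : b = a - 2 * k := by rw [← hk]; ring
    rcases int_cases h1 with ⟨m, hm⟩ | ⟨m, hm⟩
    · exact Or.inl ⟨⟨m, hm⟩, ⟨m - k, by rw [hb, hm]; push_cast; ring⟩⟩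
    · exact Or.inr ⟨⟨m, hm⟩, ⟨m - k, by rw [hb, hm]; push_cast; ring⟩⟩
  · rintro (⟨⟨m, rfl⟩, ⟨n, rfl⟩⟩ | ⟨⟨m, rfl⟩, ⟨n, rfl⟩⟩)
    · exact ⟨⟨2 * m, by push_cast; ring⟩, ⟨2 * n, by push_cast; ring⟩,
        ⟨m - n, by push_cast; ring⟩⟩
    · exact ⟨⟨2 * m + 1, by push_cast; ring⟩, ⟨2 * n + 1, by push_cast; ring⟩,
        ⟨m - n, by push_cast; ring⟩⟩

lemma diff_iff {a b : ℂ} :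
    ((∃ m : ℤ, a = m) ∧ (∃ m : ℤ, b = m) ∧ (∃ k : ℤ, b - a = 2 * k + 1)) ↔
    (Ev a ∧ Od b) ∨ (Od a ∧ Ev b) := by
  constructor
  · rintro ⟨h1, -, k, hk⟩
    have hb : b = a + 2 * k + 1 := by linear_combination hk
    rcases int_cases h1 with ⟨m, hm⟩ | ⟨m, hm⟩
    · exact Or.inl ⟨⟨m, hm⟩, ⟨m + k, by rw [hb, hm]; push_cast; ring⟩⟩
    · exact Or.inr ⟨⟨m, hm⟩, ⟨m + k + 1, by rw [hb, hm]; push_cast; ring⟩⟩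
  · rintro (⟨⟨m, rfl⟩, ⟨n, rfl⟩⟩ | ⟨⟨m, rfl⟩, ⟨n, rfl⟩⟩)
    · exact ⟨⟨2 * m, by push_cast; ring⟩, ⟨2 * n + 1, by push_cast; ring⟩,
        ⟨n - m, by push_cast; ring⟩⟩
    · exact ⟨⟨2 * m + 1, by push_cast; ring⟩, ⟨2 * n, by push_cast; ring⟩,
        ⟨n - m - 1, by push_cast; ring⟩⟩

lemma sol_cond (a0 a1 a2 a3 a4 : ℂ) :
    (∃ x y z w : ℂ → ℂ, IsRatSolD4 a0 a1 a2 a3 a4 x y z w) ↔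
      Cond (a0 + a1) (a0 - a1) (a3 + a4) (a4 - a3) := by
  rw [sol_iff]
  constructor
  · rintro ⟨x, y, z, w, h⟩
    exact necessity (osys_sys h)
  · intro h
    obtain ⟨x, e, z, f, h⟩ := sufficiency h
    exact ⟨_, _, _, _, sys_osys h⟩

/-- Theorem (classification of rational solutions of the Sasano system of type `D₄⁽¹⁾`):
the system `D₄⁽¹⁾(α₀,…,α₄)` has a rational solution iff the parameters satisfy one of six
arithmetic conditions. -/
theorem D4_has_rational_solution_iff (a0 a1 a2 a3 a4 : ℂ)
    (hsum : a0 + a1 + 2*a2 + a3 + a4 = 1) :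
    (∃ x y z w : ℂ → ℂ, IsRatSolD4 a0 a1 a2 a3 a4 x y z w) ↔
    (((∃ m : ℤ, a0 - a1 = m) ∧ (∃ m : ℤ, a3 + a4 = m) ∧
        (∃ k : ℤ, (a0 - a1) - (a3 + a4) = 2*k)) ∨
     ((∃ m : ℤ, a0 - a1 = m) ∧ (∃ m : ℤ, a3 - a4 = m) ∧
        (∃ k : ℤ, (a0 - a1) - (a3 - a4) = 2*k)) ∨
     ((∃ m : ℤ, a0 + a1 = m) ∧ (∃ m : ℤ, a3 + a4 = m) ∧
        (∃ k : ℤ, (a0 + a1) - (a3 + a4) = 2*k)) ∨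
     ((∃ m : ℤ, a0 + a1 = m) ∧ (∃ m : ℤ, a3 - a4 = m) ∧
        (∃ k : ℤ, (a0 + a1) - (a3 - a4) = 2*k)) ∨
     ((∃ m : ℤ, a0 - a1 = m) ∧ (∃ m : ℤ, a0 + a1 = m) ∧
        (∃ k : ℤ, (a0 + a1) - (a0 - a1) = 2*k + 1)) ∨
     ((∃ m : ℤ, a3 - a4 = m) ∧ (∃ m : ℤ, a3 + a4 = m) ∧
        (∃ k : ℤ, (a3 + a4) - (a3 - a4) = 2*k + 1))) := by
  rw [sol_cond, same_iff, same_iff, same_iff, same_iff, diff_iff, diff_iff]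
  unfold Cond
  rw [show a4 - a3 = -(a3 - a4) by ring, Ev_neg, Od_neg]
  have n1 : ¬ (Ev (a0 - a1) ∧ Od (a0 - a1)) := fun h => h.1.not_Od h.2
  have n2 : ¬ (Ev (a0 + a1) ∧ Od (a0 + a1)) := fun h => h.1.not_Od h.2
  have n3 : ¬ (Ev (a3 - a4) ∧ Od (a3 - a4)) := fun h => h.1.not_Od h.2
  have n4 : ¬ (Ev (a3 + a4) ∧ Od (a3 + a4)) := fun h => h.1.not_Od h.2
  grind
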